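/- arXiv:2402.17086 — 11 statements merged into one kernel-verified Lean document; each statement's English description precedes it below -/
import Mathlib

section
/- Assume the tie-null condition holds at w. Then the vector (v_1 − vol(L_1(w)), …, v_N − vol(L_N(w))) is a supergradient of K at w: for every w' ∈ ℝ^N, K(w') ≤ K(w) + Σ_{i=1}^N (v_i − vol(L_i(w)))·(w'_i − w_i). -/
open MeasureTheory

/-- The Laguerre cell of index `i` inside `Ω` for costs `c` and weights `w`. -/
def LaguerreCell {d N : ℕ} (Ω : Set (EuclideanSpace ℝ (Fin d)))
    (c : Fin N → EuclideanSpace ℝ (Fin d) → ℝ) (w : Fin N → ℝ) (i : Fin N) :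
    Set (EuclideanSpace ℝ (Fin d)) :=
  {x ∈ Ω | ∀ j, c i x - w i ≤ c j x - w j}

/-- The tie-null condition: pairwise tie sets have Lebesgue measure zero. -/
def TieNull {d N : ℕ} (Ω : Set (EuclideanSpace ℝ (Fin d)))
    (c : Fin N → EuclideanSpace ℝ (Fin d) → ℝ) (w : Fin N → ℝ) : Prop :=
  ∀ i j : Fin N, i ≠ j → volume {x ∈ Ω | c i x - w i = c j x - w j} = 0

/-- The Kantorovich dual functional
`K(w) = ∑ i, v i * w i + ∫_Ω min_i (c i x - w i)`. -/
noncomputable def Kfun {d N : ℕ} (Ω : Set (EuclideanSpace ℝ (Fin d)))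
    (c : Fin N → EuclideanSpace ℝ (Fin d) → ℝ) (v : Fin N → ℝ) (w : Fin N → ℝ) : ℝ :=
  ∑ i, v i * w i + ∫ x in Ω, ⨅ i, (c i x - w i)

/-- Under the tie-null condition at `w`, the vector
`(v i − vol(L_i(w)))_i` is a supergradient of `K` at `w`. -/
theorem Kfun_supergradient {d N : ℕ} (hd : 1 ≤ d) (hN : 1 ≤ N)
    (Ω : Set (EuclideanSpace ℝ (Fin d))) (hΩmeas : MeasurableSet Ω)
    (hΩbdd : Bornology.IsBounded Ω) (hΩfin : volume Ω < ⊤)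
    (c : Fin N → EuclideanSpace ℝ (Fin d) → ℝ)
    (hcmeas : ∀ i, Measurable (c i))
    (hcint : ∀ i, IntegrableOn (c i) Ω)
    (v : Fin N → ℝ) (hv : ∀ i, 0 ≤ v i)
    (w : Fin N → ℝ) (htie : TieNull Ω c w) :
    ∀ w' : Fin N → ℝ,
      Kfun Ω c v w' ≤ Kfun Ω c v w
        + ∑ i, (v i - (volume (LaguerreCell Ω c w i)).toReal) * (w' i - w i) := by
  intro w'
  haveI : Nonempty (Fin N) := ⟨⟨0, hN⟩⟩
  have hconst : ∀ r : ℝ, IntegrableOn (fun _ : EuclideanSpace ℝ (Fin d) => r) Ω :=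
    fun r => integrableOn_const hΩfin.ne
  have hatt : ∀ (u : Fin N → ℝ) (x : EuclideanSpace ℝ (Fin d)),
      ∃ i, c i x - u i = ⨅ i, (c i x - u i) := fun u x =>
    exists_eq_ciInf_of_finite (f := fun i => c i x - u i)
  have hle : ∀ (u : Fin N → ℝ) (x : EuclideanSpace ℝ (Fin d)) (j : Fin N),
      ⨅ i, (c i x - u i) ≤ c j x - u j := fun u x j =>
    ciInf_le (Set.finite_range (fun i => c i x - u i)).bddBelow j
  have hI : ∀ u : Fin N → ℝ, IntegrableOn (fun x => ⨅ i, (c i x - u i)) Ω := by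
    intro u
    have hg : IntegrableOn (fun x => ∑ i, |c i x - u i|) Ω := by
      refine integrable_finsetSum _ fun i _ => ?_
      exact ((hcint i).sub (hconst (u i))).abs
    refine Integrable.mono' hg ?_ ?_
    · exact (Measurable.iInf fun i => (hcmeas i).sub_const (u i)).aestronglyMeasurable
    · refine Filter.Eventually.of_forall fun x => ?_
      obtain ⟨i, hi⟩ := hatt u x
      rw [← hi, Real.norm_eq_abs]
      exact Finset.single_le_sum (f := fun i => |c i x - u i|)
        (fun j _ => abs_nonneg _) (Finset.mem_univ i)
  have hLm : ∀ i, MeasurableSet (LaguerreCell Ω c w i) := by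
    intro i
    have : LaguerreCell Ω c w i = Ω ∩ ⋂ j, {x | c i x - w i ≤ c j x - w j} := by
      ext x; simp [LaguerreCell]
    rw [this]
    exact hΩmeas.inter (MeasurableSet.iInter fun j =>
      measurableSet_le ((hcmeas i).sub_const _) ((hcmeas j).sub_const _))
  have hLsub : ∀ i, LaguerreCell Ω c w i ⊆ Ω := fun i x hx => hx.1
  let F : Fin N → EuclideanSpace ℝ (Fin d) → ℝ := fun i =>
    (LaguerreCell Ω c w i).indicator (fun _ => w' i - w i)
  have hFint : ∀ i, IntegrableOn (F i) Ω := fun i =>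
    Integrable.indicator (hconst _) (hLm i)
  have hFval : ∀ i, ∫ x in Ω, F i x
      = (volume (LaguerreCell Ω c w i)).toReal * (w' i - w i) := by
    intro i
    simp only [F]
    rw [setIntegral_indicator (hLm i), Set.inter_eq_right.mpr (hLsub i)]
    simp [Measure.real]
  have hae : ∀ᵐ x, ∀ i j : Fin N, i ≠ j → ¬ (x ∈ Ω ∧ c i x - w i = c j x - w j) := by
    rw [ae_all_iff]; intro i
    rw [ae_all_iff]; intro j
    by_cases hij : i = j
    · simp [hij]
    · have := measure_eq_zero_iff_ae_notMem.mp (htie i j hij)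
      filter_upwards [this] with x hx _ h
      exact hx h
  have hkey : ∫ x in Ω, ⨅ i, (c i x - w' i)
      ≤ ∫ x in Ω, ((⨅ i, (c i x - w i)) - ∑ i, F i x) := by
    refine setIntegral_mono_on_ae (hI w')
      ((hI w).sub (integrable_finsetSum _ fun i _ => hFint i)) hΩmeas ?_
    filter_upwards [hae] with x hx hxΩ
    obtain ⟨i, hi⟩ := hatt w x
    have hxi : x ∈ LaguerreCell Ω c w i := ⟨hxΩ, fun j => hi ▸ hle w x j⟩
    have hsum : ∑ j, F j x = w' i - w i := by
      rw [Finset.sum_eq_single i]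
      · simp [F, hxi]
      · intro j _ hji
        refine Set.indicator_of_notMem (fun hxj => ?_) _
        exact hx j i hji ⟨hxΩ, le_antisymm (hxj.2 i) (hxi.2 j)⟩
      · simp
    rw [hsum, ← hi]
    linarith [hle w' x i]
  rw [integral_sub (hI w) (integrable_finsetSum _ fun i _ => hFint i),
    integral_finsetSum _ fun i _ => hFint i] at hkey
  simp only [hFval] at hkey
  have hs : ∑ i, (v i - (volume (LaguerreCell Ω c w i)).toReal) * (w' i - w i)
      = ∑ i, v i * w' i - ∑ i, v i * w i
        - ∑ i, (volume (LaguerreCell Ω c w i)).toReal * (w' i - w i) := by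
    rw [← Finset.sum_sub_distrib, ← Finset.sum_sub_distrib]
    exact Finset.sum_congr rfl fun i _ => by ring
  unfold Kfun
  rw [hs]
  linarith
end

section
/- Assume the tie-null condition holds at w. Then K is Fréchet differentiable at w and its gradient is ∇K(w) = (v_1 − vol(L_1(w)), …, v_N − vol(L_N(w))). -/
open MeasureTheory

theorem integrable_indicator_const_aux {α E : Type*} [MeasurableSpace α]
    [NormedAddCommGroup E] (μ : Measure α) [IsFiniteMeasure μ] {s : Set α}
    (hs : MeasurableSet s) (e : E) : Integrable (s.indicator (fun _ => e)) μ :=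
  (integrable_const e).indicator hs

theorem integral_sum_indicator_aux {α E ι : Type*} [MeasurableSpace α] [Fintype ι]
    [NormedAddCommGroup E] [NormedSpace ℝ E] [CompleteSpace E] (μ : Measure α)
    [IsFiniteMeasure μ] (s : ι → Set α)
    (hs : ∀ i, MeasurableSet (s i)) (e : ι → E) (F : α → E)
    (hF : F = fun x => ∑ i, (s i).indicator (fun _ => e i) x) :
    Integrable F μ ∧ ∫ x, F x ∂μ = ∑ i, (μ (s i)).toReal • e i := by
  have hI := fun i => integrable_indicator_const_aux μ (hs i) (e i)
  subst hF
  refine ⟨integrable_finsetSum _ fun i _ => hI i, ?_⟩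
  rw [integral_finsetSum _ fun i _ => hI i]
  refine Finset.sum_congr rfl fun i _ => ?_
  rw [integral_indicator_const _ (hs i), measureReal_def]

/-- Under the tie-null condition at `w`, the functional `K` is Fréchet
differentiable at `w` with gradient `(v i − vol(L_i(w)))_i`. -/
theorem Kfun_hasFDerivAt {d N : ℕ} (hd : 1 ≤ d) (hN : 1 ≤ N)
    (Ω : Set (EuclideanSpace ℝ (Fin d))) (hΩmeas : MeasurableSet Ω)
    (hΩbdd : Bornology.IsBounded Ω) (hΩfin : volume Ω < ⊤)
    (c : Fin N → EuclideanSpace ℝ (Fin d) → ℝ)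
    (hcmeas : ∀ i, Measurable (c i))
    (hcint : ∀ i, IntegrableOn (c i) Ω)
    (v : Fin N → ℝ) (hv : ∀ i, 0 ≤ v i)
    (w : Fin N → ℝ) (htie : TieNull Ω c w) :
    HasFDerivAt (Kfun Ω c v)
      (∑ i : Fin N, (v i - (volume (LaguerreCell Ω c w i)).toReal) •
        (ContinuousLinearMap.proj i : (Fin N → ℝ) →L[ℝ] ℝ)) w := by
  have : Nonempty (Fin N) := ⟨⟨0, hN⟩⟩
  have hLmeas : ∀ i, MeasurableSet (LaguerreCell Ω c w i) := by
    intro i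
    have : LaguerreCell Ω c w i = Ω ∩ ⋂ j, {x | c i x - w i ≤ c j x - w j} := by
      ext x; simp [LaguerreCell]
    rw [this]
    exact hΩmeas.inter (MeasurableSet.iInter fun j =>
      measurableSet_le ((hcmeas i).sub_const _) ((hcmeas j).sub_const _))
  have hLsub : ∀ i, LaguerreCell Ω c w i ⊆ Ω := fun i x hx => hx.1
  have : IsFiniteMeasure (volume.restrict Ω) := ⟨by simpa using hΩfin⟩
  have hFm : ∀ u : Fin N → ℝ, Measurable (fun x => ⨅ i, (c i x - u i)) := fun u =>
    Measurable.iInf fun i => (hcmeas i).sub_const _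
  have hFint : Integrable (fun x => ⨅ i, (c i x - w i)) (volume.restrict Ω) := by
    have hb : Integrable (fun x => ∑ i, |c i x - w i|) (volume.restrict Ω) :=
      integrable_finsetSum _ fun i _ => ((hcint i).sub (integrable_const (w i))).abs
    refine hb.mono' (hFm w).aestronglyMeasurable (Filter.Eventually.of_forall fun x => ?_)
    obtain ⟨i, hi⟩ := exists_eq_ciInf_of_finite (f := fun i => c i x - w i)
    rw [← hi, Real.norm_eq_abs]
    exact Finset.single_le_sum (f := fun i => |c i x - w i|)
      (fun j _ => abs_nonneg _) (Finset.mem_univ i)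
  have hlip1 : ∀ (u u' : Fin N → ℝ) (x : EuclideanSpace ℝ (Fin d)),
      (⨅ i, (c i x - u i)) - (⨅ i, (c i x - u' i)) ≤ ‖u - u'‖ := by
    intro u u' x
    obtain ⟨i, hi⟩ := exists_eq_ciInf_of_finite (f := fun i => c i x - u' i)
    have h1 : (⨅ i, (c i x - u i)) ≤ c i x - u i := ciInf_le (Set.finite_range _).bddBelow i
    have h2 := norm_le_pi_norm (u - u') i
    rw [Real.norm_eq_abs, Pi.sub_apply] at h2
    have h3 := neg_abs_le (u i - u' i)
    rw [← hi]
    linarith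
  obtain ⟨P, hP⟩ : ∃ P : Fin N → ((Fin N → ℝ) →L[ℝ] ℝ),
      P = fun i => ContinuousLinearMap.proj i := ⟨_, rfl⟩
  obtain ⟨F', hF'⟩ : ∃ F' : EuclideanSpace ℝ (Fin d) → ((Fin N → ℝ) →L[ℝ] ℝ), F' = fun x =>
    ∑ i, (LaguerreCell Ω c w i).indicator (fun _ => -P i) x := ⟨_, rfl⟩
  obtain ⟨hF'int, hF'val⟩ :=
    integral_sum_indicator_aux (volume.restrict Ω) (LaguerreCell Ω c w) hLmeas (fun i => -P i)
      F' hF'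
  have hval : ∫ x in Ω, F' x = ∑ i, (volume (LaguerreCell Ω c w i)).toReal • (-P i) := by
    refine hF'val.trans (Finset.sum_congr rfl fun i _ => ?_)
    rw [Measure.restrict_apply (hLmeas i), Set.inter_eq_left.2 (hLsub i)]
  have hties : ∀ᵐ x ∂(volume.restrict Ω), ∀ i j, i ≠ j → c i x - w i ≠ c j x - w j := by
    rw [ae_restrict_iff' hΩmeas]
    have : ∀ i j : Fin N, ∀ᵐ x, x ∈ Ω → i ≠ j → c i x - w i ≠ c j x - w j := by
      intro i j
      by_cases hij : i = j
      · exact Filter.Eventually.of_forall fun x _ h => absurd hij h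
      · have h0 := htie i j hij
        have := measure_eq_zero_iff_ae_notMem.1 h0
        filter_upwards [this] with x hx hxΩ _ he
        exact hx ⟨hxΩ, he⟩
    have h2 := ae_all_iff.2 fun i => ae_all_iff.2 (this i)
    filter_upwards [h2] with x hx hxΩ i j
    exact hx i j hxΩ
  have hdiff : ∀ᵐ x ∂(volume.restrict Ω),
      HasFDerivAt (fun u : Fin N → ℝ => ⨅ i, (c i x - u i)) (F' x) w := by
    filter_upwards [hties, ae_restrict_mem hΩmeas] with x hx hxΩ
    obtain ⟨i, hi⟩ := exists_eq_ciInf_of_finite (f := fun i => c i x - w i)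
    have hle : ∀ j, c i x - w i ≤ c j x - w j := fun j => by
      have := ciInf_le (Set.finite_range (fun i => c i x - w i)).bddBelow j
      rw [← hi] at this
      exact this
    have hF'x : F' x = -P i := by
      rw [hF']
      beta_reduce
      rw [Finset.sum_eq_single i]
      · exact Set.indicator_of_mem (show x ∈ LaguerreCell Ω c w i from ⟨hxΩ, hle⟩) _
      · intro j _ hj
        refine Set.indicator_of_notMem (fun hm => ?_) _
        exact hx j i hj (le_antisymm (hm.2 i) (hle j))
      · simp
    rw [hF'x]
    have hbase : HasFDerivAt (fun u : Fin N → ℝ => c i x - u i) (-P i) w := by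
      rw [hP]
      exact (hasFDerivAt_apply i w).const_sub (c i x)
    refine hbase.congr_of_eventuallyEq ?_
    have hev : ∀ᶠ u : Fin N → ℝ in nhds w, ∀ j, c i x - u i ≤ c j x - u j := by
      refine Filter.eventually_all.2 fun j => ?_
      by_cases hij : i = j
      · subst hij
        exact Filter.Eventually.of_forall fun u => le_rfl
      · have hlt : c i x - w i < c j x - w j := lt_of_le_of_ne (hle j) (hx i j hij)
        have h1 : Continuous fun u : Fin N → ℝ => c i x - u i := by fun_prop
        have h2 : Continuous fun u : Fin N → ℝ => c j x - u j := by fun_prop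
        exact (h1.continuousAt.eventually_lt h2.continuousAt hlt).mono fun u hu => hu.le
    filter_upwards [hev] with u hu
    exact le_antisymm (ciInf_le (Set.finite_range _).bddBelow i) (le_ciInf hu)
  have hmain := (hasFDerivAt_integral_of_dominated_loc_of_lip'
    (F := fun (u : Fin N → ℝ) x => ⨅ i, (c i x - u i)) (F' := F') (x₀ := w)
    (μ := volume.restrict Ω) (bound := fun _ => (1 : ℝ)) (𝕜 := ℝ) Filter.univ_mem
    (fun u _ => (hFm u).aestronglyMeasurable) hFint hF'int.aestronglyMeasurable
    (Filter.Eventually.of_forall fun x u _ => by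
      rw [one_mul, Real.norm_eq_abs, abs_le]
      have h1 := hlip1 u w x
      have h2 := hlip1 w u x
      rw [norm_sub_rev] at h2
      constructor <;> linarith)
    (integrable_const _) hdiff).2
  have hlin : HasFDerivAt (fun u : Fin N → ℝ => ∑ i, v i * u i) (∑ i, v i • P i) w := by
    rw [hP]
    exact HasFDerivAt.fun_sum fun i _ => (hasFDerivAt_apply i w).const_mul (v i)
  have htot := hlin.add hmain
  rw [hval] at htot
  have heq : (∑ i : Fin N, (v i - (volume (LaguerreCell Ω c w i)).toReal) •
        (ContinuousLinearMap.proj i : (Fin N → ℝ) →L[ℝ] ℝ)) =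
      ∑ i, v i • P i + ∑ i, (volume (LaguerreCell Ω c w i)).toReal • (-P i) := by
    rw [← Finset.sum_add_distrib]
    refine Finset.sum_congr rfl fun i _ => ?_
    rw [hP]
    refine ContinuousLinearMap.ext fun u => ?_
    change (v i - (volume (LaguerreCell Ω c w i)).toReal) * u i =
      v i * u i + (volume (LaguerreCell Ω c w i)).toReal * (-u i)
    ring
  rw [heq]
  exact htot
end

section
/- Assume the tie-null condition holds at w. If w is a global maximizer of K over ℝ^N, then the volume constraints are satisfied: vol(L_i(w)) = v_i for every i = 1,…,N. -/
open MeasureTheory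

/-- A finite infimum equals a value that is attained and minimal. -/
lemma ciInf_eq_of_min {N : ℕ} (g : Fin N → ℝ) (k : Fin N) (hk : ∀ j, g k ≤ g j) :
    ⨅ j, g j = g k := by
  haveI : Nonempty (Fin N) := ⟨k⟩
  exact le_antisymm (ciInf_le (Set.finite_range g).bddBelow k) (le_ciInf hk)

/-- One-sided Lipschitz estimate for the perturbed minimum. -/
lemma inf_perturb_le {N : ℕ} [Nonempty (Fin N)] (g : Fin N → ℝ) (i : Fin N) (s t : ℝ) :
    (⨅ j, (g j - s * (if j = i then 1 else 0)))
      ≤ (⨅ j, (g j - t * (if j = i then 1 else 0))) + |s - t| := by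
  rw [← sub_le_iff_le_add]
  refine le_ciInf fun j => ?_
  have h := ciInf_le (Set.finite_range
    (fun j => g j - s * (if j = i then (1 : ℝ) else 0))).bddBelow j
  have h1 := neg_abs_le (s - t)
  have h2 := abs_nonneg (s - t)
  split_ifs at h ⊢ <;> linarith

/-- Derivative of the perturbed minimum when index `i` is the strict minimizer. -/
lemma inf_deriv_mem {N : ℕ} (g : Fin N → ℝ) (i : Fin N) (h : ∀ j, j ≠ i → g i < g j) :
    HasDerivAt (fun t : ℝ => ⨅ j, (g j - t * (if j = i then 1 else 0))) (-1) 0 := by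
  have hev : ∀ᶠ t : ℝ in nhds 0, ∀ j, j ≠ i → g i - t < g j := by
    rw [Filter.eventually_all]
    intro j
    by_cases hj : j = i
    · simp [hj]
    · have : Filter.Tendsto (fun t : ℝ => g i - t) (nhds 0) (nhds (g i - 0)) :=
        (by fun_prop : Continuous fun t : ℝ => g i - t).tendsto 0
      rw [sub_zero] at this
      filter_upwards [this.eventually_lt_const (h j hj)] with t ht _ using ht
  have hd : HasDerivAt (fun t : ℝ => g i - t) (-1) 0 := (hasDerivAt_id (0 : ℝ)).const_sub (g i)
  refine hd.congr_of_eventuallyEq ?_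
  filter_upwards [hev] with t ht
  rw [ciInf_eq_of_min _ i]
  · simp
  · intro j
    by_cases hj : j = i
    · simp [hj]
    · simpa [hj] using (ht j hj).le

/-- Derivative of the perturbed minimum when index `i` is not a minimizer. -/
lemma inf_deriv_not_mem {N : ℕ} (g : Fin N → ℝ) (i : Fin N) (h : ¬ ∀ j, g i ≤ g j) :
    HasDerivAt (fun t : ℝ => ⨅ j, (g j - t * (if j = i then 1 else 0))) 0 0 := by
  haveI : Nonempty (Fin N) := ⟨i⟩
  push Not at h
  obtain ⟨l, hl⟩ := h
  obtain ⟨k, hk⟩ := Finite.exists_min g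
  have hki : g k < g i := (hk l).trans_lt hl
  have hne : k ≠ i := by rintro rfl; exact lt_irrefl _ hki
  have hev : ∀ᶠ t : ℝ in nhds 0, g k < g i - t := by
    have : Filter.Tendsto (fun t : ℝ => g i - t) (nhds 0) (nhds (g i - 0)) :=
      (by fun_prop : Continuous fun t : ℝ => g i - t).tendsto 0
    rw [sub_zero] at this
    exact this.eventually_const_lt hki
  refine (hasDerivAt_const (0 : ℝ) (g k)).congr_of_eventuallyEq ?_
  filter_upwards [hev] with t ht
  rw [ciInf_eq_of_min _ k]
  · simp [hne]
  · intro j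
    by_cases hj : j = i
    · subst hj; simpa [hne] using ht.le
    · simpa [hj, hne] using hk j

/-- Under the tie-null condition, a global maximizer of `K` satisfies the
volume constraints `vol(L_i(w)) = v i` for every `i`. -/
theorem Kfun_maximizer_volume {d N : ℕ} (hd : 1 ≤ d) (hN : 1 ≤ N)
    (Ω : Set (EuclideanSpace ℝ (Fin d))) (hΩmeas : MeasurableSet Ω)
    (hΩbdd : Bornology.IsBounded Ω) (hΩfin : volume Ω < ⊤)
    (c : Fin N → EuclideanSpace ℝ (Fin d) → ℝ)
    (hcmeas : ∀ i, Measurable (c i))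
    (hcint : ∀ i, IntegrableOn (c i) Ω)
    (v : Fin N → ℝ) (hv : ∀ i, 0 ≤ v i)
    (w : Fin N → ℝ) (htie : TieNull Ω c w)
    (hmax : ∀ w' : Fin N → ℝ, Kfun Ω c v w' ≤ Kfun Ω c v w) :
    ∀ i, (volume (LaguerreCell Ω c w i)).toReal = v i := by
  intro i
  haveI : Nonempty (Fin N) := ⟨i⟩
  haveI : IsFiniteMeasure (volume.restrict Ω) := ⟨by simpa using hΩfin⟩
  let F : ℝ → EuclideanSpace ℝ (Fin d) → ℝ := fun t x =>
    ⨅ j, ((c j x - w j) - t * (if j = i then 1 else 0))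
  have hFmeas : ∀ t, Measurable (F t) := fun t =>
    Measurable.iInf fun j => ((hcmeas j).sub_const _).sub_const _
  have hgint : ∀ j, Integrable (fun x => c j x - w j) (volume.restrict Ω) := fun j =>
    (hcint j).sub (integrable_const _)
  have hF0 : Integrable (F 0) (volume.restrict Ω) := by
    refine Integrable.mono' (integrable_finsetSum Finset.univ fun j _ => (hgint j).abs)
      (hFmeas 0).aestronglyMeasurable (Filter.Eventually.of_forall fun x => ?_)
    obtain ⟨k, hk⟩ := Finite.exists_min fun j => c j x - w j
    have : F 0 x = c k x - w k := by
      simp only [F, zero_mul, sub_zero]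
      exact ciInf_eq_of_min _ k hk
    rw [this, Real.norm_eq_abs]
    exact Finset.single_le_sum (f := fun j => |c j x - w j|)
      (fun j _ => abs_nonneg _) (Finset.mem_univ k)
  have hLmeas : MeasurableSet (LaguerreCell Ω c w i) := by
    have : LaguerreCell Ω c w i = Ω ∩ ⋂ j, {x | c i x - w i ≤ c j x - w j} := by
      ext x; simp [LaguerreCell]
    rw [this]
    exact hΩmeas.inter (MeasurableSet.iInter fun j =>
      measurableSet_le ((hcmeas i).sub_const _) ((hcmeas j).sub_const _))
  have hnt : ∀ᵐ x ∂(volume.restrict Ω), ∀ j, j ≠ i → c i x - w i ≠ c j x - w j := by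
    rw [ae_restrict_iff' hΩmeas, ae_iff]
    refine measure_mono_null (t := ⋃ j : {j // j ≠ i},
      {x ∈ Ω | c i x - w i = c j x - w j}) ?_
      (measure_iUnion_null fun j => htie i j j.2.symm)
    intro x hx
    simp only [Set.mem_setOf_eq] at hx
    push Not at hx
    obtain ⟨hxΩ, j, hj, he⟩ := hx
    exact Set.mem_iUnion.2 ⟨⟨j, hj⟩, hxΩ, he⟩
  have hder := (hasDerivAt_integral_of_dominated_loc_of_lip (𝕜 := ℝ)
    (μ := volume.restrict Ω) (F := F) (x₀ := 0) (s := Set.univ) (bound := fun _ => 1)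
    (F' := (LaguerreCell Ω c w i).indicator fun _ => (-1 : ℝ)) Filter.univ_mem
    (Filter.Eventually.of_forall fun t => (hFmeas t).aestronglyMeasurable) hF0
    ((measurable_const.indicator hLmeas).aestronglyMeasurable)
    (Filter.Eventually.of_forall fun x => by
      refine LipschitzOnWith.of_dist_le_mul fun s _ t _ => ?_
      have h1 := inf_perturb_le (fun j => c j x - w j) i s t
      have h2 := inf_perturb_le (fun j => c j x - w j) i t s
      rw [abs_sub_comm t s] at h2
      simp only [Real.dist_eq, map_one, NNReal.coe_one, one_mul, F]
      rw [abs_le]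
      constructor <;> linarith)
    (integrable_const _)
    (by
      filter_upwards [hnt, ae_restrict_mem hΩmeas] with x hx hxΩ
      by_cases hL : x ∈ LaguerreCell Ω c w i
      · rw [Set.indicator_of_mem hL]
        exact inf_deriv_mem (fun j => c j x - w j) i fun j hj =>
          lt_of_le_of_ne (hL.2 j) (hx j hj)
      · rw [Set.indicator_of_notMem hL]
        exact inf_deriv_not_mem (fun j => c j x - w j) i fun h => hL ⟨hxΩ, h⟩)).2
  have hint : ∫ x in Ω, (LaguerreCell Ω c w i).indicator (fun _ => (-1 : ℝ)) x
      = -(volume (LaguerreCell Ω c w i)).toReal := by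
    have hsub : LaguerreCell Ω c w i ∩ Ω = LaguerreCell Ω c w i :=
      Set.inter_eq_left.2 fun x hx => hx.1
    rw [integral_indicator hLmeas, Measure.restrict_restrict hLmeas, hsub]
    simp [Measure.real]
  rw [hint] at hder
  have hK : ∀ t : ℝ, Kfun Ω c v (fun j => w j + t * (if j = i then 1 else 0))
      = (∑ j, v j * w j + t * v i) + ∫ x in Ω, F t x := by
    intro t
    unfold Kfun
    congr 1
    · simp [mul_add, Finset.sum_add_distrib, mul_comm]
    · simp only [F, sub_sub]
  have hdK : HasDerivAt (fun t : ℝ => (∑ j, v j * w j + t * v i) + ∫ x in Ω, F t x)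
      (1 * v i + -(volume (LaguerreCell Ω c w i)).toReal) 0 :=
    (((hasDerivAt_id (0 : ℝ)).mul_const (v i)).const_add _).add hder
  have hloc : IsLocalMax (fun t : ℝ => (∑ j, v j * w j + t * v i) + ∫ x in Ω, F t x) 0 := by
    refine Filter.Eventually.of_forall fun t => ?_
    simp only [← hK]
    simpa using hmax _
  have := hloc.hasDerivAt_eq_zero hdK
  linarith
end

section
/- Strong duality at a Laguerre tessellation: assume the tie-null condition holds at w and that vol(L_i(w)) = v_i for every i. Then the total transport cost of the Laguerre tessellation attains the dual value: Σ_{i=1}^N ∫_{L_i(w)} c_i(x) dx = K(w). -/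
open MeasureTheory

/-- Strong duality: when the Laguerre cells of `w` satisfy the volume
constraints, their total transport cost attains the dual value `K(w)`. -/
theorem strong_duality {d N : ℕ} (hd : 1 ≤ d) (hN : 1 ≤ N)
    (Ω : Set (EuclideanSpace ℝ (Fin d))) (hΩmeas : MeasurableSet Ω)
    (hΩbdd : Bornology.IsBounded Ω) (hΩfin : volume Ω < ⊤)
    (c : Fin N → EuclideanSpace ℝ (Fin d) → ℝ)
    (hcmeas : ∀ i, Measurable (c i))
    (hcint : ∀ i, IntegrableOn (c i) Ω)
    (v : Fin N → ℝ) (hv : ∀ i, 0 ≤ v i)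
    (w : Fin N → ℝ) (htie : TieNull Ω c w)
    (hvol : ∀ i, (volume (LaguerreCell Ω c w i)).toReal = v i) :
    ∑ i, ∫ x in LaguerreCell Ω c w i, c i x = Kfun Ω c v w := by
  have : Nonempty (Fin N) := ⟨⟨0, hN⟩⟩
  have hsub : ∀ i, LaguerreCell Ω c w i ⊆ Ω := fun i x hx => hx.1
  have hmeas : ∀ i, MeasurableSet (LaguerreCell Ω c w i) := by
    intro i
    have h : LaguerreCell Ω c w i = Ω ∩ ⋂ j, {x | c i x - w i ≤ c j x - w j} := by
      ext x
      simp [LaguerreCell]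
    rw [h]
    exact hΩmeas.inter (MeasurableSet.iInter fun j =>
      measurableSet_le ((hcmeas i).sub_const _) ((hcmeas j).sub_const _))
  have hU : ⋃ i, LaguerreCell Ω c w i = Ω := by
    ext x
    simp only [Set.mem_iUnion]
    refine ⟨fun ⟨i, hi⟩ => hsub i hi, fun hx => ?_⟩
    obtain ⟨i, hi⟩ := Finite.exists_min (fun i => c i x - w i)
    exact ⟨i, hx, hi⟩
  have heq : ∀ i, Set.EqOn (fun x => c i x - w i) (fun x => ⨅ j, (c j x - w j))
      (LaguerreCell Ω c w i) := by
    intro i x hx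
    exact le_antisymm (le_ciInf hx.2) (ciInf_le (Set.finite_range _).bddBelow i)
  have hci : ∀ i, IntegrableOn (c i) (LaguerreCell Ω c w i) :=
    fun i => (hcint i).mono_set (hsub i)
  have hfin : ∀ i, volume (LaguerreCell Ω c w i) ≠ ⊤ :=
    fun i => ((measure_mono (hsub i)).trans_lt hΩfin).ne
  have hwi : ∀ i, IntegrableOn (fun _ => w i) (LaguerreCell Ω c w i) :=
    fun i => integrableOn_const (hfin i)
  have hfi : ∀ i, IntegrableOn (fun x => ⨅ j, (c j x - w j)) (LaguerreCell Ω c w i) :=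
    fun i => ((hci i).sub (hwi i)).congr_fun (heq i) (hmeas i)
  have hdisj : Pairwise (Function.onFun (AEDisjoint volume) (LaguerreCell Ω c w)) := by
    intro i j hij
    refine measure_mono_null ?_ (htie i j hij)
    rintro x ⟨hi, hj⟩
    exact ⟨hi.1, le_antisymm (hi.2 j) (hj.2 i)⟩
  have hint : ∫ x in Ω, ⨅ j, (c j x - w j)
      = ∑ i, ∫ x in LaguerreCell Ω c w i, ⨅ j, (c j x - w j) := by
    conv_lhs => rw [← hU]
    rw [integral_iUnion_ae (fun i => (hmeas i).nullMeasurableSet) hdisj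
      (integrableOn_finite_iUnion.2 hfi), tsum_fintype]
  rw [Kfun, hint, ← Finset.sum_add_distrib]
  refine Finset.sum_congr rfl fun i _ => ?_
  rw [← setIntegral_congr_fun (hmeas i) (heq i), integral_sub (hci i) (hwi i),
    setIntegral_const, Measure.real, hvol, smul_eq_mul]
  ring
end

section
/- Optimality of the Laguerre tessellation among volume-constrained partitions: assume the tie-null condition holds at w and that vol(L_i(w)) = v_i for every i. Then for every family of measurable sets S_1,…,S_N ⊆ Ω that are pairwise disjoint up to Lebesgue-null sets, whose union covers Ω up to a Lebesgue-null set, and which satisfy vol(S_i) = v_i for every i, one has Σ_{i=1}^N ∫_{S_i} c_i(x) dx ≥ Σ_{i=1}^N ∫_{L_i(w)} c_i(x) dx. -/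
open MeasureTheory

/-- Optimality of the Laguerre tessellation among all measurable
volume-constrained a.e.-partitions of `Ω`. -/
theorem laguerre_optimal {d N : ℕ} (hd : 1 ≤ d) (hN : 1 ≤ N)
    (Ω : Set (EuclideanSpace ℝ (Fin d))) (hΩmeas : MeasurableSet Ω)
    (hΩbdd : Bornology.IsBounded Ω) (hΩfin : volume Ω < ⊤)
    (c : Fin N → EuclideanSpace ℝ (Fin d) → ℝ)
    (hcmeas : ∀ i, Measurable (c i))
    (hcint : ∀ i, IntegrableOn (c i) Ω)
    (v : Fin N → ℝ) (hv : ∀ i, 0 ≤ v i)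
    (w : Fin N → ℝ) (htie : TieNull Ω c w)
    (hvol : ∀ i, (volume (LaguerreCell Ω c w i)).toReal = v i)
    (S : Fin N → Set (EuclideanSpace ℝ (Fin d)))
    (hSsub : ∀ i, S i ⊆ Ω)
    (hSmeas : ∀ i, MeasurableSet (S i))
    (hSdisj : ∀ i j : Fin N, i ≠ j → volume (S i ∩ S j) = 0)
    (hScover : volume (Ω \ ⋃ i, S i) = 0)
    (hSvol : ∀ i, (volume (S i)).toReal = v i) :
    ∑ i, ∫ x in LaguerreCell Ω c w i, c i x ≤ ∑ i, ∫ x in S i, c i x := by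
  classical
  have hne : (Finset.univ : Finset (Fin N)).Nonempty := ⟨⟨0, hN⟩, Finset.mem_univ _⟩
  obtain ⟨m, hm⟩ : ∃ m : EuclideanSpace ℝ (Fin d) → ℝ,
      m = fun x => Finset.univ.inf' hne (fun j => c j x - w j) := ⟨_, rfl⟩
  have hm_le : ∀ x j, m x ≤ c j x - w j := by
    intro x j
    rw [hm]
    exact Finset.inf'_le (fun j => c j x - w j) (Finset.mem_univ j)
  have hm_ex : ∀ x, ∃ j, m x = c j x - w j := by
    intro x
    obtain ⟨j, -, hj⟩ := Finset.exists_mem_eq_inf' hne (fun j => c j x - w j)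
    exact ⟨j, by rw [hm]; exact hj⟩
  have hm_meas : Measurable m := by
    have h : Measurable (Finset.univ.inf' hne (fun j x => c j x - w j)) :=
      Finset.inf'_induction hne _ (fun _ hf _ hg => hf.inf hg)
        (fun j _ => (hcmeas j).sub_const (w j))
    have h2 : m = Finset.univ.inf' hne (fun j x => c j x - w j) := by
      funext x
      rw [hm, Finset.inf'_apply]
    rw [h2]
    exact h
  have hgint : ∀ i, IntegrableOn (fun x => c i x - w i) Ω := fun i =>
    (hcint i).sub (integrableOn_const hΩfin.ne)
  have hm_int : IntegrableOn m Ω := by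
    have hg : IntegrableOn (fun x => ∑ j, |c j x - w j|) Ω :=
      integrable_finsetSum _ (fun j _ => (hgint j).abs)
    refine Integrable.mono' hg hm_meas.aestronglyMeasurable (Filter.Eventually.of_forall ?_)
    intro x
    obtain ⟨j, hj⟩ := hm_ex x
    rw [hj, Real.norm_eq_abs]
    exact Finset.single_le_sum (f := fun j => |c j x - w j|)
      (fun k _ => abs_nonneg _) (Finset.mem_univ j)
  have hLsub : ∀ i, LaguerreCell Ω c w i ⊆ Ω := fun i x hx => hx.1
  have hLmeas : ∀ i, MeasurableSet (LaguerreCell Ω c w i) := by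
    intro i
    have : LaguerreCell Ω c w i = Ω ∩ ⋂ j, {x | c i x - w i ≤ c j x - w j} := by
      ext x; simp [LaguerreCell]
    rw [this]
    exact hΩmeas.inter (MeasurableSet.iInter fun j =>
      measurableSet_le ((hcmeas i).sub_const _) ((hcmeas j).sub_const _))
  have hLdisj : ∀ i j : Fin N, i ≠ j →
      volume (LaguerreCell Ω c w i ∩ LaguerreCell Ω c w j) = 0 := by
    intro i j hij
    refine measure_mono_null ?_ (htie i j hij)
    rintro x ⟨h1, h2⟩
    exact ⟨h1.1, le_antisymm (h1.2 j) (h2.2 i)⟩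
  have hLcover : volume (Ω \ ⋃ i, LaguerreCell Ω c w i) = 0 := by
    have : Ω \ ⋃ i, LaguerreCell Ω c w i = ∅ := by
      rw [Set.sdiff_eq_empty]
      intro x hx
      obtain ⟨i, hi⟩ := hm_ex x
      exact Set.mem_iUnion.2 ⟨i, hx, fun j => hi ▸ hm_le x j⟩
    rw [this, measure_empty]
  have key : ∀ T : Fin N → Set (EuclideanSpace ℝ (Fin d)), (∀ i, T i ⊆ Ω) →
      (∀ i, MeasurableSet (T i)) → (∀ i j : Fin N, i ≠ j → volume (T i ∩ T j) = 0) →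
      volume (Ω \ ⋃ i, T i) = 0 → ∑ i, ∫ x in T i, m x = ∫ x in Ω, m x := by
    intro T h1 h2 h3 h4
    have hsub : (⋃ i, T i) ⊆ Ω := Set.iUnion_subset h1
    have h5 : (⋃ i, T i) =ᵐ[volume] Ω :=
      Filter.EventuallyLE.antisymm (LE.le.eventuallyLE hsub) (ae_le_set.2 h4)
    rw [← setIntegral_congr_set h5, integral_iUnion_ae (fun i => (h2 i).nullMeasurableSet)
      (fun i j hij => h3 i j hij) (hm_int.mono_set hsub), tsum_fintype]
  have hsplit : ∀ (T : Set (EuclideanSpace ℝ (Fin d))) (i : Fin N), T ⊆ Ω →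
      ∫ x in T, (c i x - w i) = (∫ x in T, c i x) - (volume T).toReal * w i := by
    intro T i hT
    rw [integral_sub ((hcint i).mono_set hT)
      (integrableOn_const ((measure_mono hT).trans_lt hΩfin).ne), setIntegral_const]
    rfl
  have hL : ∑ i, ∫ x in LaguerreCell Ω c w i, (c i x - w i) = ∫ x in Ω, m x := by
    rw [← key _ hLsub hLmeas hLdisj hLcover]
    refine Finset.sum_congr rfl fun i _ => setIntegral_congr_fun (hLmeas i) ?_
    intro x hx
    obtain ⟨j, hj⟩ := hm_ex x
    exact le_antisymm (by rw [hj]; exact hx.2 j) (hm_le x i)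
  have hS : ∫ x in Ω, m x ≤ ∑ i, ∫ x in S i, (c i x - w i) := by
    rw [← key _ hSsub hSmeas hSdisj hScover]
    exact Finset.sum_le_sum fun i _ => setIntegral_mono (hm_int.mono_set (hSsub i))
      ((hgint i).mono_set (hSsub i)) (fun x => hm_le x i)
  rw [← hL] at hS
  simp only [hsplit _ _ (hLsub _), hsplit _ _ (hSsub _), hvol, hSvol,
    Finset.sum_sub_distrib] at hS
  linarith
end

section
/- Uniqueness of the optimal volume-constrained partition: assume the tie-null condition holds at w and that vol(L_i(w)) = v_i for every i. If S_1,…,S_N ⊆ Ω are measurable sets that are pairwise disjoint up to Lebesgue-null sets, whose union covers Ω up to a Lebesgue-null set, which satisfy vol(S_i) = v_i for every i, and which achieve the same total cost, Σ_{i=1}^N ∫_{S_i} c_i(x) dx = Σ_{i=1}^N ∫_{L_i(w)} c_i(x) dx, then S_i coincides with L_i(w) up to a Lebesgue-null set (vol(S_i Δ L_i(w)) = 0) for every i. -/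
open MeasureTheory

theorem laguerre_aux_partition {d N : ℕ} (Ω : Set (EuclideanSpace ℝ (Fin d)))
    (m : EuclideanSpace ℝ (Fin d) → ℝ) (hm : IntegrableOn m Ω)
    (S : Fin N → Set (EuclideanSpace ℝ (Fin d)))
    (hSsub : ∀ i, S i ⊆ Ω)
    (hSmeas : ∀ i, MeasurableSet (S i))
    (hSdisj : ∀ i j : Fin N, i ≠ j → volume (S i ∩ S j) = 0)
    (hScover : volume (Ω \ ⋃ i, S i) = 0) :
    ∑ i, ∫ x in S i, m x = ∫ x in Ω, m x := by
  have hsub : (⋃ i, S i) ⊆ Ω := Set.iUnion_subset hSsub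
  have h1 : (⋃ i, S i) =ᵐ[volume] Ω :=
    Filter.EventuallyLE.antisymm hsub.eventuallyLE (ae_le_set.2 hScover)
  rw [← setIntegral_congr_set h1,
    integral_iUnion_ae (fun i => (hSmeas i).nullMeasurableSet) (fun i j hij => hSdisj i j hij)
      (hm.mono_set hsub), tsum_fintype]

/-- Uniqueness of the optimal volume-constrained partition: an a.e.-partition
with the prescribed volumes achieving the cost of the Laguerre tessellation
must coincide with the Laguerre cells up to Lebesgue-null sets. -/
theorem laguerre_unique_optimal {d N : ℕ} (hd : 1 ≤ d) (hN : 1 ≤ N)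
    (Ω : Set (EuclideanSpace ℝ (Fin d))) (hΩmeas : MeasurableSet Ω)
    (hΩbdd : Bornology.IsBounded Ω) (hΩfin : volume Ω < ⊤)
    (c : Fin N → EuclideanSpace ℝ (Fin d) → ℝ)
    (hcmeas : ∀ i, Measurable (c i))
    (hcint : ∀ i, IntegrableOn (c i) Ω)
    (v : Fin N → ℝ) (hv : ∀ i, 0 ≤ v i)
    (w : Fin N → ℝ) (htie : TieNull Ω c w)
    (hvol : ∀ i, (volume (LaguerreCell Ω c w i)).toReal = v i)
    (S : Fin N → Set (EuclideanSpace ℝ (Fin d)))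
    (hSsub : ∀ i, S i ⊆ Ω)
    (hSmeas : ∀ i, MeasurableSet (S i))
    (hSdisj : ∀ i j : Fin N, i ≠ j → volume (S i ∩ S j) = 0)
    (hScover : volume (Ω \ ⋃ i, S i) = 0)
    (hSvol : ∀ i, (volume (S i)).toReal = v i)
    (hSopt : ∑ i, ∫ x in S i, c i x = ∑ i, ∫ x in LaguerreCell Ω c w i, c i x) :
    ∀ i, volume (symmDiff (S i) (LaguerreCell Ω c w i)) = 0 := by
  classical
  have hne : (Finset.univ : Finset (Fin N)).Nonempty := ⟨⟨0, hN⟩, Finset.mem_univ _⟩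
  let g : Fin N → EuclideanSpace ℝ (Fin d) → ℝ := fun i x => c i x - w i
  let m : EuclideanSpace ℝ (Fin d) → ℝ := fun x => Finset.univ.inf' hne (fun i => g i x)
  have hgm : ∀ i, Measurable (g i) := fun i => (hcmeas i).sub_const _
  have hconst : ∀ a : ℝ, IntegrableOn (fun _ : EuclideanSpace ℝ (Fin d) => a) Ω := fun a =>
    integrableOn_const hΩfin.ne
  have hgi : ∀ i, IntegrableOn (g i) Ω := fun i => (hcint i).sub (hconst (w i))
  have hmle : ∀ i x, m x ≤ g i x := fun i x => Finset.inf'_le _ (Finset.mem_univ i)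
  have hmex : ∀ x, ∃ i, m x = g i x := fun x => by
    obtain ⟨i, -, hi⟩ := Finset.exists_mem_eq_inf' hne (fun i => g i x)
    exact ⟨i, hi⟩
  have hmmeas : Measurable m := by
    have h : Measurable (Finset.univ.inf' hne g) :=
      Finset.inf'_induction hne g (fun _ h1 _ h2 => h1.inf h2) (fun i _ => hgm i)
    have e : m = Finset.univ.inf' hne g := by
      funext x
      simp [m, Finset.inf'_apply]
    rw [e]; exact h
  have hmint : IntegrableOn m Ω := by
    have hs : Integrable (fun x => ∑ i, ‖g i x‖) (volume.restrict Ω) :=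
      integrable_finsetSum _ (fun i _ => (hgi i).norm)
    refine hs.mono' hmmeas.aestronglyMeasurable (Filter.Eventually.of_forall fun x => ?_)
    obtain ⟨i, hi⟩ := hmex x
    rw [hi]
    exact Finset.single_le_sum (f := fun i => ‖g i x‖) (fun _ _ => norm_nonneg _)
      (Finset.mem_univ i)
  have hLsub : ∀ i, LaguerreCell Ω c w i ⊆ Ω := fun i x hx => hx.1
  have hLmeas : ∀ i, MeasurableSet (LaguerreCell Ω c w i) := fun i => by
    have : LaguerreCell Ω c w i = Ω ∩ ⋂ j, {x | g i x ≤ g j x} := by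
      ext x; simp [LaguerreCell, g]
    rw [this]
    exact hΩmeas.inter (MeasurableSet.iInter fun j => measurableSet_le (hgm i) (hgm j))
  have hLiff : ∀ i x, x ∈ Ω → g i x = m x → x ∈ LaguerreCell Ω c w i := fun i x hx h =>
    ⟨hx, fun j => h.le.trans (hmle j x)⟩
  have hLeq : ∀ i x, x ∈ LaguerreCell Ω c w i → g i x = m x := fun i x hx => by
    obtain ⟨j, hj⟩ := hmex x
    exact le_antisymm (by rw [hj]; exact hx.2 j) (hmle i x)
  have hLdisj : ∀ i j : Fin N, i ≠ j →
      volume (LaguerreCell Ω c w i ∩ LaguerreCell Ω c w j) = 0 := fun i j hij =>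
    measure_mono_null (t := {x ∈ Ω | c i x - w i = c j x - w j})
      (fun x hx => ⟨hx.1.1, le_antisymm (hx.1.2 j) (hx.2.2 i)⟩) (htie i j hij)
  have hLcover : volume (Ω \ ⋃ i, LaguerreCell Ω c w i) = 0 := by
    have : Ω \ ⋃ i, LaguerreCell Ω c w i = ∅ := by
      rw [Set.sdiff_eq_empty]
      intro x hx
      obtain ⟨i, hi⟩ := hmex x
      exact Set.mem_iUnion.2 ⟨i, hLiff i x hx hi.symm⟩
    rw [this, measure_empty]
  have hSm := laguerre_aux_partition Ω m hmint S hSsub hSmeas hSdisj hScover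
  have hLm := laguerre_aux_partition Ω m hmint _ hLsub hLmeas hLdisj hLcover
  have hgA : ∀ (A : Set (EuclideanSpace ℝ (Fin d))) (i : Fin N), A ⊆ Ω →
      ∫ x in A, g i x = (∫ x in A, c i x) - (volume A).toReal * w i := fun A i hA => by
    have h := integral_sub ((hcint i).mono_set hA) ((hconst (w i)).mono_set hA)
    rw [setIntegral_const] at h
    simpa [g, Measure.real] using h
  have hLg : ∑ i, ∫ x in LaguerreCell Ω c w i, g i x = ∫ x in Ω, m x := by
    rw [← hLm]
    exact Finset.sum_congr rfl fun i _ => setIntegral_congr_fun (hLmeas i) (hLeq i)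
  have hSg : ∑ i, ∫ x in S i, g i x = ∫ x in Ω, m x := by
    rw [← hLg, Finset.sum_congr rfl fun i _ => hgA (S i) i (hSsub i),
      Finset.sum_congr rfl fun i _ => hgA (LaguerreCell Ω c w i) i (hLsub i)]
    simp only [Finset.sum_sub_distrib, hSvol, hvol, hSopt]
  have hdiff : ∀ i, IntegrableOn (fun x => g i x - m x) (S i) := fun i =>
    ((hgi i).mono_set (hSsub i)).sub (hmint.mono_set (hSsub i))
  have hnn : ∀ i, 0 ≤ fun x => g i x - m x := fun i x => sub_nonneg.2 (hmle i x)
  have hzero : ∑ i, ∫ x in S i, (g i x - m x) = 0 := by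
    have : ∀ i, ∫ x in S i, (g i x - m x) = (∫ x in S i, g i x) - ∫ x in S i, m x := fun i =>
      integral_sub ((hgi i).mono_set (hSsub i)) (hmint.mono_set (hSsub i))
    simp only [this, Finset.sum_sub_distrib, hSg, hSm, sub_self]
  intro i
  have hzi : ∫ x in S i, (g i x - m x) = 0 :=
    (Finset.sum_eq_zero_iff_of_nonneg (fun i _ => integral_nonneg (hnn i))).1 hzero i
      (Finset.mem_univ i)
  have hae := (integral_eq_zero_iff_of_nonneg (hnn i) (hdiff i)).1 hzi
  have hSL : volume (S i \ LaguerreCell Ω c w i) = 0 := by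
    have h2 := (ae_restrict_iff' (hSmeas i)).1 hae
    refine measure_mono_null (fun x hx => ?_) (ae_iff.1 h2)
    intro h
    exact hx.2 (hLiff i x (hSsub i hx.1) (sub_eq_zero.1 (h hx.1)))
  have hfS : volume (S i) ≠ ⊤ := (measure_mono (hSsub i)).trans_lt hΩfin |>.ne
  have hfL : volume (LaguerreCell Ω c w i) ≠ ⊤ := (measure_mono (hLsub i)).trans_lt hΩfin |>.ne
  have hEq : volume (S i) = volume (LaguerreCell Ω c w i) :=
    (ENNReal.toReal_eq_toReal_iff' hfS hfL).1 ((hSvol i).trans (hvol i).symm)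
  have haeq : S i =ᵐ[volume] LaguerreCell Ω c w i :=
    ae_eq_of_ae_subset_of_measure_ge (ae_le_set.2 hSL) hEq.ge (hSmeas i).nullMeasurableSet hfL
  exact measure_symmDiff_eq_zero_iff.2 haeq
end

section
/- Pushforward property of the Laguerre assignment map: let x_1,…,x_N ∈ ℝ^d be pairwise distinct points, let c_i(x) = c(x, x_i) for a measurable function c : ℝ^d × ℝ^d → ℝ, assume the tie-null condition holds at w, and assume vol(L_i(w)) = v_i for every i. Define T : Ω → ℝ^d by T(x) = x_i where i is the least index with x ∈ L_i(w). Then T is measurable and the pushforward of the Lebesgue measure restricted to Ω under T equals the discrete measure Σ_{i=1}^N v_i δ_{x_i}. -/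
open MeasureTheory

open Classical in
/-- The assignment map: `x ↦ pts i` where `i` is the least index with
`x ∈ L i`, and `x ↦ x` if `x` lies in no cell. -/
noncomputable def assignMap {d N : ℕ} (pts : Fin N → EuclideanSpace ℝ (Fin d))
    (L : Fin N → Set (EuclideanSpace ℝ (Fin d))) (x : EuclideanSpace ℝ (Fin d)) :
    EuclideanSpace ℝ (Fin d) :=
  if h : ∃ i, x ∈ L i then
    pts ((Finset.univ.filter (fun i => x ∈ L i)).min'
      (by obtain ⟨i, hi⟩ := h
          exact ⟨i, Finset.mem_filter.mpr ⟨Finset.mem_univ i, hi⟩⟩))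
  else x

/-- On the `i`-th cell minus the earlier cells, the assignment map is `pts i`. -/
theorem assignMap_eq_of_first {d N : ℕ} (pts : Fin N → EuclideanSpace ℝ (Fin d))
    (L : Fin N → Set (EuclideanSpace ℝ (Fin d))) (x : EuclideanSpace ℝ (Fin d)) (i : Fin N)
    (hi : x ∈ L i) (hlt : ∀ j < i, x ∉ L j) : assignMap pts L x = pts i := by
  classical
  have h : ∃ i, x ∈ L i := ⟨i, hi⟩
  unfold assignMap
  rw [dif_pos h]
  congr 1
  apply le_antisymm
  · exact Finset.min'_le _ _ (by simp [hi])
  · apply Finset.le_min'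
    intro j hj
    by_contra hji
    exact hlt j (not_le.mp hji) (by simpa using hj)

theorem exists_first_cell {d N : ℕ} (L : Fin N → Set (EuclideanSpace ℝ (Fin d)))
    (x : EuclideanSpace ℝ (Fin d)) (h : ∃ i, x ∈ L i) :
    ∃ i, x ∈ L i ∧ ∀ j < i, x ∉ L j := by
  obtain ⟨i, hi, hmin⟩ := WellFounded.has_min (wellFounded_lt (α := Fin N)) {i | x ∈ L i} h
  exact ⟨i, hi, fun j hj hx => hmin j hx hj⟩

/-- Pushforward property of the Laguerre assignment map: it is measurable and
pushes the Lebesgue measure restricted to `Ω` forward to `∑ i, v i • δ_{x i}`. -/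
theorem assignMap_pushforward {d N : ℕ} (hd : 1 ≤ d) (hN : 1 ≤ N)
    (Ω : Set (EuclideanSpace ℝ (Fin d))) (hΩmeas : MeasurableSet Ω)
    (hΩbdd : Bornology.IsBounded Ω) (hΩfin : volume Ω < ⊤)
    (pts : Fin N → EuclideanSpace ℝ (Fin d))
    (hpts : Function.Injective pts)
    (c : EuclideanSpace ℝ (Fin d) → EuclideanSpace ℝ (Fin d) → ℝ)
    (hcmeas : Measurable (Function.uncurry c))
    (v : Fin N → ℝ) (hv : ∀ i, 0 ≤ v i)
    (w : Fin N → ℝ)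
    (htie : TieNull Ω (fun i x => c x (pts i)) w)
    (hvol : ∀ i, (volume (LaguerreCell Ω (fun i x => c x (pts i)) w i)).toReal = v i) :
    Measurable (assignMap pts (LaguerreCell Ω (fun i x => c x (pts i)) w)) ∧
      Measure.map (assignMap pts (LaguerreCell Ω (fun i x => c x (pts i)) w))
          (volume.restrict Ω)
        = ∑ i, ENNReal.ofReal (v i) • Measure.dirac (pts i) := by
  classical
  set L := LaguerreCell Ω (fun i x => c x (pts i)) w with hL
  have hcm : ∀ i, Measurable (fun x => c x (pts i)) := fun i =>
    hcmeas.comp (measurable_id.prodMk measurable_const)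
  have hLm : ∀ i, MeasurableSet (L i) := by
    intro i
    have : L i = Ω ∩ ⋂ j, {x | c x (pts i) - w i ≤ c x (pts j) - w j} := by
      ext x
      simp [hL, LaguerreCell]
    rw [this]
    exact hΩmeas.inter (MeasurableSet.iInter fun j =>
      measurableSet_le ((hcm i).sub_const _) ((hcm j).sub_const _))
  have hLΩ : ∀ i, L i ⊆ Ω := fun i x hx => hx.1
  have hcover : ∀ x ∈ Ω, ∃ i, x ∈ L i := by
    intro x hx
    have : Nonempty (Fin N) := ⟨⟨0, hN⟩⟩
    obtain ⟨i, hi⟩ := Finite.exists_min (fun i => c x (pts i) - w i)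
    exact ⟨i, hx, hi⟩
  let D : Fin N → Set (EuclideanSpace ℝ (Fin d)) := fun i => {x | x ∈ L i ∧ ∀ j < i, x ∉ L j}
  have hDm : ∀ i, MeasurableSet (D i) := by
    intro i
    have : D i = L i ∩ ⋂ j, ⋂ (_ : j < i), (L j)ᶜ := by
      ext x
      simp [D]
    rw [this]
    exact (hLm i).inter (MeasurableSet.iInter fun j => MeasurableSet.iInter fun _ => (hLm j).compl)
  have hDvol : ∀ i, volume (D i) = ENNReal.ofReal (v i) := by
    intro i
    have hfin : volume (L i) ≠ ⊤ := ((measure_mono (hLΩ i)).trans_lt hΩfin).ne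
    rw [← hvol i, ENNReal.ofReal_toReal hfin]
    apply le_antisymm
    · exact measure_mono fun x hx => hx.1
    · have hsub : L i ⊆ D i ∪ ⋃ j, ⋃ (_ : i ≠ j),
          {x ∈ Ω | c x (pts i) - w i = c x (pts j) - w j} := by
        intro x hx
        by_cases hxD : x ∈ D i
        · exact Or.inl hxD
        · right
          have : ∃ j < i, x ∈ L j := by
            by_contra hcon
            push Not at hcon
            exact hxD ⟨hx, hcon⟩
          obtain ⟨j, hj, hxj⟩ := this
          simp only [Set.mem_iUnion]
          exact ⟨j, hj.ne', hx.1, le_antisymm (hx.2 j) (hxj.2 i)⟩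
      have hnull : volume (⋃ j, ⋃ (_ : i ≠ j),
          {x ∈ Ω | c x (pts i) - w i = c x (pts j) - w j}) = 0 := by
        rw [measure_iUnion_null_iff]
        intro j
        rw [measure_iUnion_null_iff]
        intro hij
        exact htie i j hij
      calc volume (L i) ≤ _ := measure_mono hsub
        _ ≤ _ := measure_union_le _ _
        _ = volume (D i) := by rw [hnull, add_zero]
  have hpre : ∀ S : Set (EuclideanSpace ℝ (Fin d)),
      assignMap pts L ⁻¹' S ∩ Ω = ⋃ i, D i ∩ {_x | pts i ∈ S} := by
    intro S
    ext x
    simp only [Set.mem_inter_iff, Set.mem_preimage, Set.mem_iUnion, Set.mem_ofPred_eq]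
    constructor
    · rintro ⟨hxS, hxΩ⟩
      obtain ⟨i, hi, hlt⟩ := exists_first_cell L x (hcover x hxΩ)
      rw [assignMap_eq_of_first pts L x i hi hlt] at hxS
      exact ⟨i, ⟨hi, hlt⟩, hxS⟩
    · rintro ⟨i, hi, hS⟩
      rw [assignMap_eq_of_first pts L x i hi.1 hi.2]
      exact ⟨hS, hLΩ i hi.1⟩
  have hpm : ∀ (S : Set (EuclideanSpace ℝ (Fin d))) (i : Fin N), MeasurableSet (D i ∩ {_x : EuclideanSpace ℝ (Fin d) | pts i ∈ S}) :=
    fun S i => (hDm i).inter (MeasurableSet.const _)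
  have hT : Measurable (assignMap pts L) := by
    intro S hS
    have : assignMap pts L ⁻¹' S = (⋃ i, D i ∩ {_x | pts i ∈ S}) ∪ (S ∩ Ωᶜ) := by
      rw [← hpre S]
      ext x
      by_cases hx : x ∈ Ω
      · simp [hx]
      · have hno : ¬ ∃ i, x ∈ L i := fun ⟨i, hi⟩ => hx (hLΩ i hi)
        have : assignMap pts L x = x := by
          unfold assignMap
          rw [dif_neg hno]
        simp [hx, this]
    rw [this]
    exact (MeasurableSet.iUnion (hpm S)).union (hS.inter hΩmeas.compl)
  refine ⟨hT, ?_⟩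
  ext S hS
  rw [Measure.map_apply hT hS, Measure.restrict_apply (hT hS), hpre S,
    measure_iUnion _ (hpm S), tsum_fintype]
  · simp only [Measure.finsetSum_apply, Measure.smul_apply, smul_eq_mul]
    refine Finset.sum_congr rfl fun i _ => ?_
    rw [Measure.dirac_apply' _ hS]
    by_cases h : pts i ∈ S
    · simp [h, hDvol]
    · simp [h]
  · intro i j hij
    refine Set.disjoint_left.mpr ?_
    rintro x ⟨hxi, -⟩ ⟨hxj, -⟩
    rcases lt_or_gt_of_ne hij with h | h
    · exact hxj.2 i h hxi.1
    · exact hxi.2 j h hxj.1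
end

section
/- The Laguerre assignment map solves the semi-discrete Monge problem: let x_1,…,x_N ∈ ℝ^d be pairwise distinct points, let c : ℝ^d × ℝ^d → ℝ be measurable with each c_i := c(·, x_i) integrable on Ω, assume the tie-null condition holds at w, and assume vol(L_i(w)) = v_i for every i. Define T : Ω → ℝ^d by T(x) = x_i where i is the least index with x ∈ L_i(w). Then for every measurable map T' : Ω → ℝ^d taking values in {x_1,…,x_N} whose pushforward of the Lebesgue measure restricted to Ω equals Σ_{i=1}^N v_i δ_{x_i}, one has ∫_Ω c(x, T(x)) dx ≤ ∫_Ω c(x, T'(x)) dx. -/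
open MeasureTheory

/-- The integral of a function assembled from `f i` on the cells `A i`, in terms of the
reduced function obtained by subtracting the weights. -/
theorem integral_of_cells {X : Type*} [MeasurableSpace X] {N : ℕ} (μ : Measure X)
    [IsFiniteMeasure μ] (f : Fin N → X → ℝ) (hf : ∀ i, Integrable (f i) μ)
    (A : Fin N → Set X) (hA : ∀ i, MeasurableSet (A i)) (w v : Fin N → ℝ)
    (hv : ∀ i, (μ (A i)).toReal = v i) (F : X → ℝ)
    (hF : ∀ᵐ x ∂μ, ∃ k, x ∈ A k ∧ (∀ j, x ∈ A j → j = k) ∧ F x = f k x) :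
    Integrable (fun x => ∑ i, (A i).indicator (fun x => f i x - w i) x) μ ∧
    ∫ x, F x ∂μ = ∫ x, ∑ i, (A i).indicator (fun x => f i x - w i) x ∂μ + ∑ i, w i * v i := by
  have h1 : ∀ i, Integrable ((A i).indicator (fun x => f i x - w i)) μ := fun i =>
    ((hf i).sub (integrable_const _)).indicator (hA i)
  have h2 : ∀ i, Integrable ((A i).indicator (fun _ => w i)) μ := fun i =>
    (integrable_const _).indicator (hA i)
  have h3 : Integrable (fun x => ∑ i, (A i).indicator (fun x => f i x - w i) x) μ :=
    integrable_finsetSum _ fun i _ => h1 i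
  refine ⟨h3, ?_⟩
  have h4 : ∑ i, w i * v i = ∫ x, ∑ i, (A i).indicator (fun _ => w i) x ∂μ := by
    rw [integral_finsetSum _ fun i _ => h2 i]
    refine Finset.sum_congr rfl fun i _ => ?_
    rw [integral_indicator_const _ (hA i), ← hv i, Measure.real, smul_eq_mul, mul_comm]
  rw [h4, ← integral_add h3 (integrable_finsetSum _ fun i _ => h2 i)]
  refine integral_congr_ae ?_
  filter_upwards [hF] with x hx
  obtain ⟨k, hk, hu, hFx⟩ := hx
  rw [← Finset.sum_add_distrib, Finset.sum_eq_single k]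
  · simp [hk, hFx]
  · intro j _ hj
    have : x ∉ A j := fun h => hj (hu j h)
    simp [this]
  · simp

/-- Value at a point of a sum over disjoint cells. -/
theorem sum_cells_apply {X : Type*} {N : ℕ} (g : Fin N → X → ℝ) (A : Fin N → Set X) (x : X)
    (k : Fin N) (hk : x ∈ A k) (hu : ∀ j, x ∈ A j → j = k) :
    ∑ i, (A i).indicator (g i) x = g k x := by
  rw [Finset.sum_eq_single k]
  · simp [hk]
  · intro j _ hj
    have : x ∉ A j := fun h => hj (hu j h)
    simp [this]
  · simp

/-- The Laguerre assignment map solves the semi-discrete Monge problem: its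
transport cost is minimal among all measurable maps with values in the points
`pts i` pushing `vol|_Ω` forward to `∑ i, v i • δ_{pts i}`. -/
theorem assignMap_solves_monge {d N : ℕ} (hd : 1 ≤ d) (hN : 1 ≤ N)
    (Ω : Set (EuclideanSpace ℝ (Fin d))) (hΩmeas : MeasurableSet Ω)
    (hΩbdd : Bornology.IsBounded Ω) (hΩfin : volume Ω < ⊤)
    (pts : Fin N → EuclideanSpace ℝ (Fin d))
    (hpts : Function.Injective pts)
    (c : EuclideanSpace ℝ (Fin d) → EuclideanSpace ℝ (Fin d) → ℝ)
    (hcmeas : Measurable (Function.uncurry c))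
    (hcint : ∀ i, IntegrableOn (fun x => c x (pts i)) Ω)
    (v : Fin N → ℝ) (hv : ∀ i, 0 ≤ v i)
    (w : Fin N → ℝ)
    (htie : TieNull Ω (fun i x => c x (pts i)) w)
    (hvol : ∀ i, (volume (LaguerreCell Ω (fun i x => c x (pts i)) w i)).toReal = v i)
    (T' : EuclideanSpace ℝ (Fin d) → EuclideanSpace ℝ (Fin d))
    (hT'meas : Measurable T')
    (hT'range : ∀ x ∈ Ω, ∃ i, T' x = pts i)
    (hT'push : Measure.map T' (volume.restrict Ω)
      = ∑ i, ENNReal.ofReal (v i) • Measure.dirac (pts i)) :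
    ∫ x in Ω, c x (assignMap pts (LaguerreCell Ω (fun i x => c x (pts i)) w) x)
      ≤ ∫ x in Ω, c x (T' x) := by
  have : IsFiniteMeasure (volume.restrict Ω) := ⟨by simpa using hΩfin⟩
  set f : Fin N → EuclideanSpace ℝ (Fin d) → ℝ := fun i x => c x (pts i) with hfdef
  have hfm : ∀ i, Measurable (f i) := fun i =>
    hcmeas.comp (measurable_id.prodMk measurable_const)
  set L := LaguerreCell Ω f w with hL
  have hLm : ∀ i, MeasurableSet (L i) := fun i => by
    have : L i = Ω ∩ ⋂ j, {x | f i x - w i ≤ f j x - w j} := by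
      ext x; simp [hL, LaguerreCell]
    rw [this]
    exact hΩmeas.inter (MeasurableSet.iInter fun j =>
      measurableSet_le ((hfm i).sub_const _) ((hfm j).sub_const _))
  have hLΩ : ∀ i, L i ⊆ Ω := fun i x hx => hx.1
  have hLv : ∀ i, ((volume.restrict Ω) (L i)).toReal = v i := fun i => by
    rw [Measure.restrict_apply (hLm i), Set.inter_eq_left.mpr (hLΩ i), hvol i]
  have htie' : ∀ᵐ x ∂(volume.restrict Ω), ∀ i j : Fin N, i ≠ j → f i x - w i ≠ f j x - w j := by
    rw [ae_all_iff]; intro i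
    rw [ae_all_iff]; intro j
    by_cases hij : i = j
    · exact Filter.Eventually.of_forall fun x h => absurd hij h
    · rw [ae_restrict_iff' hΩmeas]
      have h0 := htie i j hij
      rw [measure_eq_zero_iff_ae_notMem] at h0
      filter_upwards [h0] with x hx hxΩ _ he
      exact hx ⟨hxΩ, he⟩
  have hLae : ∀ᵐ x ∂(volume.restrict Ω), ∃ k, x ∈ L k ∧ (∀ j, x ∈ L j → j = k) ∧
      c x (assignMap pts L x) = f k x := by
    filter_upwards [htie', ae_restrict_mem hΩmeas] with x hx hxΩ
    have : Nonempty (Fin N) := ⟨⟨0, hN⟩⟩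
    obtain ⟨m, hm⟩ := Finite.exists_min (fun i => f i x - w i)
    have hex : ∃ i, x ∈ L i := ⟨m, hxΩ, hm⟩
    have huniq : ∀ i j, x ∈ L i → x ∈ L j → i = j := fun i j hi hj => by
      by_contra hne
      exact hx i j hne (le_antisymm (hi.2 j) (hj.2 i))
    classical
    have hne : (Finset.univ.filter (fun i => x ∈ L i)).Nonempty := by
      obtain ⟨i, hi⟩ := hex
      exact ⟨i, Finset.mem_filter.mpr ⟨Finset.mem_univ i, hi⟩⟩
    have hmem := (Finset.mem_filter.mp (Finset.min'_mem _ hne)).2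
    refine ⟨_, hmem, fun j hj => huniq _ _ hj hmem, ?_⟩
    rw [assignMap, dif_pos hex]
  set B : Fin N → Set (EuclideanSpace ℝ (Fin d)) := fun i => T' ⁻¹' {pts i} with hB
  have hBm : ∀ i, MeasurableSet (B i) := fun i => hT'meas (measurableSet_singleton _)
  have hBv : ∀ i, ((volume.restrict Ω) (B i)).toReal = v i := fun i => by
    rw [hB, ← Measure.map_apply hT'meas (measurableSet_singleton _), hT'push,
      Measure.finsetSum_apply, Finset.sum_eq_single i]
    · simp [hv i]
    · intro j _ hj
      have : pts j ≠ pts i := fun h => hj (hpts h)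
      simp [this]
    · simp
  have hBpt : ∀ x ∈ Ω, ∃ k, x ∈ B k ∧ (∀ j, x ∈ B j → j = k) ∧ c x (T' x) = f k x := by
    intro x hx
    obtain ⟨k, hk⟩ := hT'range x hx
    refine ⟨k, hk, fun j hj => hpts ?_, by rw [hk]⟩
    rw [← hk]; exact hj.symm
  obtain ⟨i1, e1⟩ := integral_of_cells (volume.restrict Ω) f hcint L hLm w v hLv _ hLae
  obtain ⟨i2, e2⟩ := integral_of_cells (volume.restrict Ω) f hcint B hBm w v hBv
    (fun x => c x (T' x)) ((ae_restrict_mem hΩmeas).mono hBpt)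
  rw [e1, e2]
  gcongr ?_ + _
  refine integral_mono_ae i1 i2 ?_
  filter_upwards [hLae, ae_restrict_mem hΩmeas] with x hx hxΩ
  obtain ⟨k, hk, hu, -⟩ := hx
  obtain ⟨l, hl, hu', -⟩ := hBpt x hxΩ
  rw [sum_cells_apply (fun i x => f i x - w i) L x k hk hu,
    sum_cells_apply (fun i x => f i x - w i) B x l hl hu']
  exact hk.2 l
end

section
/- Existence of Kantorovich potentials: let Ω ⊆ ℝ^d be compact with vol(Ω) > 0, let c_1,…,c_N : ℝ^d → ℝ be continuous, assume that for all i ≠ j and all s ∈ ℝ the set {x ∈ Ω : c_i(x) − c_j(x) = s} has Lebesgue measure zero, and let v_1,…,v_N > 0 with Σ_{i=1}^N v_i = vol(Ω). Then there exists a weight vector w ∈ ℝ^N such that vol(L_i(w)) = v_i for every i = 1,…,N. -/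
open MeasureTheory

theorem LC_closed {d N : ℕ} (Ω : Set (EuclideanSpace ℝ (Fin d))) (hΩcomp : IsCompact Ω)
    (c : Fin N → EuclideanSpace ℝ (Fin d) → ℝ)
    (hccont : ∀ i, Continuous (c i)) (w : Fin N → ℝ) (i : Fin N) :
    IsClosed (LaguerreCell Ω c w i) := by
  have : LaguerreCell Ω c w i = Ω ∩ ⋂ j, {x | c i x - w i ≤ c j x - w j} := by
    ext x; simp [LaguerreCell]
  rw [this]
  refine hΩcomp.isClosed.inter (isClosed_iInter fun j => ?_)
  exact isClosed_le ((hccont i).sub continuous_const) ((hccont j).sub continuous_const)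

theorem LC_noties {d N : ℕ} (Ω : Set (EuclideanSpace ℝ (Fin d))) (hΩcomp : IsCompact Ω)
    (c : Fin N → EuclideanSpace ℝ (Fin d) → ℝ)
    (hgen : ∀ i j : Fin N, i ≠ j → ∀ s : ℝ,
      volume {x ∈ Ω | c i x - c j x = s} = 0) (w : Fin N → ℝ) :
    ∀ᵐ x ∂(volume.restrict Ω), ∀ i j, i ≠ j → c i x - w i ≠ c j x - w j := by
  rw [ae_restrict_iff' hΩcomp.measurableSet]
  have : ∀ i j, i ≠ j → ∀ᵐ x, x ∈ Ω → c i x - w i ≠ c j x - w j := by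
    intro i j hij
    have h := hgen i j hij (w i - w j)
    rw [ae_iff]
    refine measure_mono_null ?_ h
    intro x hx
    simp only [Set.mem_setOf_eq, not_forall, not_not] at hx ⊢
    obtain ⟨h1, h2⟩ := hx
    exact ⟨h1, by linarith⟩
  have h2 : ∀ᵐ x, ∀ i j, i ≠ j → x ∈ Ω → c i x - w i ≠ c j x - w j := by
    rw [ae_all_iff]; intro i
    rw [ae_all_iff]; intro j
    by_cases hij : i = j
    · simp [hij]
    · filter_upwards [this i j hij] with x hx _ using hx
  filter_upwards [h2] with x hx hxΩ i j hij using hx i j hij hxΩ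

theorem LC_cont {d N : ℕ} (Ω : Set (EuclideanSpace ℝ (Fin d))) (hΩcomp : IsCompact Ω)
    (c : Fin N → EuclideanSpace ℝ (Fin d) → ℝ)
    (hccont : ∀ i, Continuous (c i))
    (hgen : ∀ i j : Fin N, i ≠ j → ∀ s : ℝ,
      volume {x ∈ Ω | c i x - c j x = s} = 0) (i : Fin N) :
    Continuous (fun w : Fin N → ℝ => (volume (LaguerreCell Ω c w i)).toReal) := by
  have hfin : IsFiniteMeasure (volume.restrict Ω) :=
    ⟨by simpa using hΩcomp.measure_lt_top⟩
  have heq : (fun w : Fin N → ℝ => (volume (LaguerreCell Ω c w i)).toReal) =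
      fun w => ∫ x, (LaguerreCell Ω c w i).indicator (fun _ => (1:ℝ)) x ∂(volume.restrict Ω) := by
    funext w
    rw [integral_indicator (LC_closed Ω hΩcomp c hccont w i).measurableSet]
    rw [Measure.restrict_restrict (LC_closed Ω hΩcomp c hccont w i).measurableSet]
    have : LaguerreCell Ω c w i ∩ Ω = LaguerreCell Ω c w i :=
      Set.inter_eq_left.2 fun x hx => hx.1
    rw [this]; simp [Measure.real]
  rw [heq, continuous_iff_continuousAt]
  intro w
  refine continuousAt_of_dominated (bound := fun _ => 1) ?_ ?_ (integrable_const _) ?_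
  · refine Filter.Eventually.of_forall fun w => ?_
    exact ((measurable_const.indicator
      (LC_closed Ω hΩcomp c hccont w i).measurableSet)).aestronglyMeasurable
  · refine Filter.Eventually.of_forall fun w => Filter.Eventually.of_forall fun x => ?_
    by_cases hx : x ∈ LaguerreCell Ω c w i <;> simp [hx]
  · filter_upwards [LC_noties Ω hΩcomp c hgen w, ae_restrict_mem hΩcomp.measurableSet]
      with x hx hxΩ
    have key : ∀ᶠ w' in nhds w, (x ∈ LaguerreCell Ω c w' i ↔ x ∈ LaguerreCell Ω c w i) := by
      have : ∀ᶠ w' in nhds w, ∀ j,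
          (c i x - w' i ≤ c j x - w' j ↔ c i x - w i ≤ c j x - w j) := by
        rw [Filter.eventually_all]
        intro j
        by_cases hij : i = j
        · subst hij; simp
        have c1 : ∀ k, ContinuousAt (fun w' : Fin N → ℝ => c k x - w' k) w := fun k =>
          (continuous_const.sub (continuous_apply k)).continuousAt
        rcases lt_or_gt_of_ne (hx i j hij) with h | h
        · filter_upwards [(c1 i).eventually_lt (c1 j) h] with w' hw'
          exact ⟨fun _ => h.le, fun _ => hw'.le⟩
        · filter_upwards [(c1 j).eventually_lt (c1 i) h] with w' hw'
          exact ⟨fun h' => absurd h' (not_le.2 hw'), fun h' => absurd h' (not_le.2 h)⟩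
      filter_upwards [this] with w' hw'
      simp only [LaguerreCell, Set.mem_setOf_eq, hw']
    refine ContinuousAt.congr (continuousAt_const (y := (LaguerreCell Ω c w i).indicator (fun _ => (1:ℝ)) x)) ?_
    filter_upwards [key] with w' hw'
    by_cases h : x ∈ LaguerreCell Ω c w i
    · simp [h, hw'.2 h]
    · simp [h, mt hw'.1 h]

theorem LC_sum {d N : ℕ} (hN : 1 ≤ N) (Ω : Set (EuclideanSpace ℝ (Fin d))) (hΩcomp : IsCompact Ω)
    (c : Fin N → EuclideanSpace ℝ (Fin d) → ℝ)
    (hccont : ∀ i, Continuous (c i))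
    (hgen : ∀ i j : Fin N, i ≠ j → ∀ s : ℝ,
      volume {x ∈ Ω | c i x - c j x = s} = 0) (w : Fin N → ℝ) :
    ∑ i, (volume (LaguerreCell Ω c w i)).toReal = (volume Ω).toReal := by
  have hU : (⋃ i, LaguerreCell Ω c w i) = Ω := by
    ext x
    simp only [Set.mem_iUnion]
    constructor
    · rintro ⟨i, hi⟩; exact hi.1
    · intro hx
      have : Nonempty (Fin N) := ⟨⟨0, hN⟩⟩
      obtain ⟨i, hi⟩ := Finite.exists_min (fun i => c i x - w i)
      exact ⟨i, hx, hi⟩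
  have hlt : ∀ i, volume (LaguerreCell Ω c w i) ≠ ⊤ := fun i =>
    ((measure_mono (fun x hx => hx.1)).trans_lt hΩcomp.measure_lt_top).ne
  rw [← ENNReal.toReal_sum (fun i _ => hlt i)]
  conv_rhs => rw [← hU]
  rw [measure_iUnion₀, tsum_fintype]
  · intro i j hij
    refine measure_mono_null ?_ (hgen i j hij (w i - w j))
    rintro x ⟨h1, h2⟩
    exact ⟨h1.1, by linarith [h1.2 j, h2.2 i]⟩
  · exact fun i => (LC_closed Ω hΩcomp c hccont w i).measurableSet.nullMeasurableSet

/-- Existence of Kantorovich potentials: for a compact domain of positive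
volume, continuous costs whose pairwise difference level sets are Lebesgue-null,
and positive target volumes summing to `vol Ω`, there is a weight vector whose
Laguerre cells have exactly the prescribed volumes. -/
theorem exists_kantorovich_potentials {d N : ℕ} (hd : 1 ≤ d) (hN : 1 ≤ N)
    (Ω : Set (EuclideanSpace ℝ (Fin d))) (hΩcomp : IsCompact Ω)
    (hΩpos : 0 < volume Ω)
    (c : Fin N → EuclideanSpace ℝ (Fin d) → ℝ)
    (hccont : ∀ i, Continuous (c i))
    (hgen : ∀ i j : Fin N, i ≠ j → ∀ s : ℝ,
      volume {x ∈ Ω | c i x - c j x = s} = 0)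
    (v : Fin N → ℝ) (hv : ∀ i, 0 < v i)
    (hvsum : ∑ i, v i = (volume Ω).toReal) :
    ∃ w : Fin N → ℝ, ∀ i, (volume (LaguerreCell Ω c w i)).toReal = v i := by
  have hcont := LC_cont Ω hΩcomp c hccont hgen
  have hsum := LC_sum hN Ω hΩcomp c hccont hgen
  have hlt : ∀ w i, volume (LaguerreCell Ω c w i) ≠ ⊤ := fun w i =>
    ((measure_mono (fun x hx => hx.1)).trans_lt hΩcomp.measure_lt_top).ne
  set m : (Fin N → ℝ) → Fin N → ℝ := fun w i => (volume (LaguerreCell Ω c w i)).toReal with hm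
  let o : Fin N := ⟨0, hN⟩
  obtain ⟨C, hC0, hC⟩ : ∃ C : ℝ, 0 ≤ C ∧ ∀ i, ∀ x ∈ Ω, |c i x| ≤ C := by
    have : ∀ i, ∃ C, ∀ x ∈ Ω, ‖c i x‖ ≤ C := fun i =>
      hΩcomp.exists_bound_of_continuousOn (hccont i).continuousOn
    choose B hB using this
    refine ⟨∑ i, |B i|, Finset.sum_nonneg fun i _ => abs_nonneg _, fun i x hx => ?_⟩
    calc |c i x| ≤ B i := hB i x hx
      _ ≤ |B i| := le_abs_self _
      _ ≤ _ := Finset.single_le_sum (f := fun i => |B i|) (fun i _ => abs_nonneg _)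
        (Finset.mem_univ i)
  have hempty : ∀ w i j, w i + 2 * C < w j → m w i = 0 := by
    intro w i j h
    have : LaguerreCell Ω c w i = ∅ := by
      ext x
      simp only [Set.mem_empty_iff_false, iff_false]
      rintro ⟨hx, h2⟩
      have := h2 j
      have h3 := abs_le.1 (hC i x hx)
      have h4 := abs_le.1 (hC j x hx)
      linarith [h3.1, h4.2]
    simp [hm, this]
  let M : ℝ := 2 * C + 1
  let K : Set (Fin N → ℝ) := Set.Icc (fun _ => -M) (fun _ => M) ∩
    ({w | w o = 0} ∩ ⋂ i, {w | i ≠ o → m w i ≤ v i})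
  have hKc : IsCompact K := by
    refine isCompact_Icc.inter_right (IsClosed.inter ?_ (isClosed_iInter fun i => ?_))
    · exact isClosed_eq (continuous_apply o) continuous_const
    · by_cases hi : i = o
      · simp [hi]
      · simp only [ne_eq, hi, not_false_eq_true, true_imp_iff]
        exact isClosed_le (hcont i) continuous_const
  have hKmem : ∀ w, w ∈ K ↔ (∀ i, -M ≤ w i ∧ w i ≤ M) ∧ w o = 0 ∧ ∀ i, i ≠ o → m w i ≤ v i := by
    intro w
    simp only [K, Set.mem_inter_iff, Set.mem_Icc, Pi.le_def, Set.mem_setOf_eq, Set.mem_iInter,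
      forall_and]
  have hKne : K.Nonempty := by
    refine ⟨Function.update (fun _ => -M) o 0, (hKmem _).2 ⟨fun i => ?_, by simp, fun i hi => ?_⟩⟩
    · by_cases hi : i = o
      · subst hi; simp only [Function.update_self]; constructor <;> simp only [M] <;> linarith
      · simp only [Function.update_of_ne hi]; constructor <;> simp only [M] <;> linarith
    · rw [hempty _ i o]
      · exact (hv i).le
      · simp only [Function.update_self, Function.update_of_ne hi, M]; linarith
  obtain ⟨w, hwK, hmax⟩ := hKc.exists_isMaxOn hKne
    (f := fun w : Fin N → ℝ => ∑ i, w i) (by fun_prop)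
  obtain ⟨hbox, hwo, hwm⟩ := (hKmem w).1 hwK
  have hupper : ∀ i, w i ≤ 2 * C := by
    intro i
    by_contra h
    push Not at h
    have h0 := hempty w o i (by rw [hwo]; linarith)
    have : ∑ i, m w i < ∑ i, v i := by
      refine Finset.sum_lt_sum (fun j _ => ?_) ⟨o, Finset.mem_univ _, by rw [h0]; exact hv o⟩
      by_cases hj : j = o
      · rw [hj, h0]; exact (hv o).le
      · exact hwm j hj
    rw [hvsum] at this
    exact this.ne (hsum w)
  have heq : ∀ i, i ≠ o → m w i = v i := by
    intro i hi
    by_contra hne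
    have hlti := lt_of_le_of_ne (hwm i hi) hne
    have hct : ContinuousAt (fun t => m (Function.update w i t) i) (w i) :=
      ((hcont i).comp (continuous_const.update i continuous_id)).continuousAt
    have e1 : ∀ᶠ t in nhds (w i), m (Function.update w i t) i < v i :=
      hct.eventually_lt continuousAt_const (by simpa using hlti)
    have e2 : ∀ᶠ t in nhds (w i), t < M := by
      refine gt_mem_nhds ?_
      have := hupper i
      simp only [M]; linarith
    obtain ⟨t, ⟨ht1, ht2⟩, ht3⟩ := (((e1.and e2).filter_mono nhdsWithin_le_nhds).and
      (self_mem_nhdsWithin : Set.Ioi (w i) ∈ nhdsWithin (w i) (Set.Ioi (w i)))).exists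
    have ht3 : w i < t := ht3
    have hmem : Function.update w i t ∈ K := by
      refine (hKmem _).2 ⟨fun j => ?_, ?_, fun j hj => ?_⟩
      · by_cases hj : j = i
        · subst hj; simp only [Function.update_self]
          exact ⟨by linarith [(hbox j).1], ht2.le⟩
        · simp only [Function.update_of_ne hj]; exact hbox j
      · rw [Function.update_of_ne (Ne.symm hi)]; exact hwo
      · by_cases hji : j = i
        · subst hji; exact ht1.le
        · refine le_trans ?_ (hwm j hj)
          refine ENNReal.toReal_mono (hlt _ _) (measure_mono ?_)
          rintro x ⟨hx, h2⟩
          refine ⟨hx, fun k => ?_⟩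
          have := h2 k
          rw [Function.update_of_ne hji] at this
          by_cases hk : k = i
          · subst hk; rw [Function.update_self] at this; linarith
          · rwa [Function.update_of_ne hk] at this
    have hle := hmax hmem
    simp only [Set.mem_setOf_eq] at hle
    have : ∑ j, w j < ∑ j, Function.update w i t j := by
      refine Finset.sum_lt_sum (fun j _ => ?_) ⟨i, Finset.mem_univ _, by simpa using ht3⟩
      by_cases hj : j = i
      · subst hj; simpa using ht3.le
      · rw [Function.update_of_ne hj]
    linarith
  refine ⟨w, fun i => ?_⟩
  by_cases hi : i = o
  · have h1 : ∑ i, m w i = ∑ i, v i := by rw [hvsum]; exact hsum w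
    rw [← Finset.add_sum_erase _ _ (Finset.mem_univ o),
      ← Finset.add_sum_erase _ v (Finset.mem_univ o),
      Finset.sum_congr rfl (fun j hj => heq j (Finset.ne_of_mem_erase hj))] at h1
    rw [hi]
    exact add_right_cancel h1
  · exact heq i hi
end

section
/- Uniqueness of Kantorovich potentials up to an additive constant: let Ω ⊆ ℝ^d be the closure of a nonempty bounded connected open set, let c_1,…,c_N : ℝ^d → ℝ be continuous, assume that for all i ≠ j and all s ∈ ℝ the set {x ∈ Ω : c_i(x) − c_j(x) = s} has Lebesgue measure zero, and let v_1,…,v_N > 0 with Σ_{i=1}^N v_i = vol(Ω). If w, w' ∈ ℝ^N both satisfy the volume constraints vol(L_i(w)) = v_i = vol(L_i(w')) for every i, then there exists t ∈ ℝ such that w'_i = w_i + t for every i. -/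
open MeasureTheory

lemma laguerre_isClosed {d N : ℕ} (Ω : Set (EuclideanSpace ℝ (Fin d))) (hΩ : IsClosed Ω)
    (c : Fin N → EuclideanSpace ℝ (Fin d) → ℝ) (hc : ∀ i, Continuous (c i))
    (w : Fin N → ℝ) (i : Fin N) : IsClosed (LaguerreCell Ω c w i) := by
  have : LaguerreCell Ω c w i = Ω ∩ ⋂ j, {x | c i x - w i ≤ c j x - w j} := by
    ext x; simp [LaguerreCell]
  rw [this]
  exact hΩ.inter (isClosed_iInter fun j =>
    isClosed_le ((hc i).sub continuous_const) ((hc j).sub continuous_const))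

lemma laguerre_union_real {d N : ℕ} (Ω : Set (EuclideanSpace ℝ (Fin d))) (hΩ : IsClosed Ω)
    (hfin : volume Ω ≠ ⊤)
    (c : Fin N → EuclideanSpace ℝ (Fin d) → ℝ) (hc : ∀ i, Continuous (c i))
    (hgen : ∀ i j : Fin N, i ≠ j → ∀ s : ℝ, volume {x ∈ Ω | c i x - c j x = s} = 0)
    (v w : Fin N → ℝ) (hw : ∀ i, (volume (LaguerreCell Ω c w i)).toReal = v i)
    (S : Finset (Fin N)) :
    (volume (⋃ i ∈ S, LaguerreCell Ω c w i)).toReal = ∑ i ∈ S, v i := by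
  rw [measure_biUnion_finset₀, ENNReal.toReal_sum]
  · exact Finset.sum_congr rfl fun i _ => hw i
  · intro i _
    exact ne_top_of_le_ne_top hfin (measure_mono fun x hx => hx.1)
  · intro i _ j _ hij
    refine measure_mono_null ?_ (hgen i j hij (w i - w j))
    rintro x ⟨h1, h2⟩
    exact ⟨h1.1, by linarith [h1.2 j, h2.2 i]⟩
  · intro i _
    exact (laguerre_isClosed Ω hΩ c hc w i).measurableSet.nullMeasurableSet

/-- Uniqueness of Kantorovich potentials up to an additive constant, on the
closure of a nonempty bounded connected open set. -/
theorem kantorovich_potentials_unique {d N : ℕ} (hd : 1 ≤ d) (hN : 1 ≤ N)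
    (U : Set (EuclideanSpace ℝ (Fin d))) (hUopen : IsOpen U)
    (hUne : U.Nonempty) (hUbdd : Bornology.IsBounded U)
    (hUconn : IsConnected U)
    (c : Fin N → EuclideanSpace ℝ (Fin d) → ℝ)
    (hccont : ∀ i, Continuous (c i))
    (hgen : ∀ i j : Fin N, i ≠ j → ∀ s : ℝ,
      volume {x ∈ closure U | c i x - c j x = s} = 0)
    (v : Fin N → ℝ) (hv : ∀ i, 0 < v i)
    (hvsum : ∑ i, v i = (volume (closure U)).toReal)
    (w w' : Fin N → ℝ)
    (hw : ∀ i, (volume (LaguerreCell (closure U) c w i)).toReal = v i)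
    (hw' : ∀ i, (volume (LaguerreCell (closure U) c w' i)).toReal = v i) :
    ∃ t : ℝ, ∀ i, w' i = w i + t := by
  classical
  have hΩ : IsClosed (closure U) := isClosed_closure
  have hfin : volume (closure U) ≠ ⊤ := hUbdd.closure.measure_lt_top.ne
  have : Nonempty (Fin N) := ⟨⟨0, hN⟩⟩
  obtain ⟨i0, hi0⟩ := Finite.exists_max (fun i => w' i - w i)
  refine ⟨w' i0 - w i0, ?_⟩
  by_contra hcon
  push Not at hcon
  obtain ⟨j0, hj0⟩ := hcon
  let S : Finset (Fin N) := Finset.univ.filter fun i => w' i - w i = w' i0 - w i0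
  have hi0S : i0 ∈ S := by simp [S]
  have hj0S : j0 ∈ Sᶜ := by
    simp only [S, Finset.mem_compl, Finset.mem_filter, Finset.mem_univ, true_and]
    intro h; apply hj0; linarith
  set A := ⋃ i ∈ S, LaguerreCell (closure U) c w i with hA
  set B := ⋃ i ∈ Sᶜ, LaguerreCell (closure U) c w' i with hB
  have hAc : IsClosed A := isClosed_biUnion_finset fun i _ => laguerre_isClosed _ hΩ c hccont w i
  have hBc : IsClosed B := isClosed_biUnion_finset fun i _ => laguerre_isClosed _ hΩ c hccont w' i
  have hvA := laguerre_union_real _ hΩ hfin c hccont hgen v w hw S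
  have hvB := laguerre_union_real _ hΩ hfin c hccont hgen v w' hw' Sᶜ
  rw [← hA] at hvA
  rw [← hB] at hvB
  have hAs : A ⊆ closure U := Set.iUnion₂_subset fun i _ x hx => hx.1
  have hBs : B ⊆ closure U := Set.iUnion₂_subset fun i _ x hx => hx.1
  have hdisj : Disjoint A B := by
    rw [Set.disjoint_left]
    intro x hxA hxB
    simp only [hA, hB, Set.mem_iUnion] at hxA hxB
    obtain ⟨i, hi, hxi⟩ := hxA
    obtain ⟨j, hj, hxj⟩ := hxB
    simp only [S, Finset.mem_compl, Finset.mem_filter, Finset.mem_univ, true_and] at hi hj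
    have h1 := hxi.2 j
    have h2 := hxj.2 i
    exact hj (le_antisymm (hi0 j) (by linarith))
  have hABs : A ∪ B ⊆ closure U := Set.union_subset hAs hBs
  have hAf : volume A ≠ ⊤ := ne_top_of_le_ne_top hfin (measure_mono hAs)
  have hBf : volume B ≠ ⊤ := ne_top_of_le_ne_top hfin (measure_mono hBs)
  have hvol : volume (A ∪ B) = volume (closure U) := by
    rw [measure_union hdisj hBc.measurableSet,
      ← ENNReal.toReal_eq_toReal_iff' (ENNReal.add_ne_top.2 ⟨hAf, hBf⟩) hfin,
      ENNReal.toReal_add hAf hBf, hvA, hvB, Finset.sum_add_sum_compl, hvsum]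
  have hnull : volume (closure U \ (A ∪ B)) = 0 := by
    rw [measure_diff hABs (hAc.union hBc).measurableSet.nullMeasurableSet
      (ne_top_of_le_ne_top hfin (measure_mono hABs)), hvol, tsub_self]
  have hUsub : U ⊆ A ∪ B := by
    have h0 : volume (U \ (A ∪ B)) = 0 :=
      measure_mono_null (Set.diff_subset_diff_left subset_closure) hnull
    have ho : IsOpen (U \ (A ∪ B)) := hUopen.sdiff (hAc.union hBc)
    exact Set.diff_eq_empty.1 ((ho.measure_eq_zero_iff volume).1 h0)
  have hpos : ∀ (T : Finset (Fin N)) (i : Fin N), i ∈ T → 0 < ∑ i ∈ T, v i :=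
    fun T i hi => Finset.sum_pos (fun i _ => hv i) ⟨i, hi⟩
  rcases isPreconnected_iff_subset_of_disjoint_closed.1 hUconn.isPreconnected A B hAc hBc hUsub
    (by rw [hdisj.inter_eq, Set.inter_empty]) with h | h
  · have hcl := closure_minimal h hAc
    have hBe : B = ∅ := Set.eq_empty_of_forall_notMem fun x hx =>
      Set.disjoint_left.1 hdisj (hcl (hBs hx)) hx
    have := hpos _ _ hj0S
    rw [← hvB, hBe] at this
    simp at this
  · have hcl := closure_minimal h hBc
    have hAe : A = ∅ := Set.eq_empty_of_forall_notMem fun x hx =>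
      Set.disjoint_left.1 hdisj hx (hcl (hAs hx))
    have := hpos _ _ hi0S
    rw [← hvA, hAe] at this
    simp at this
end

section
/- Envelope formula for the incompressibility force with the squared Euclidean cost: let Ω ⊆ ℝ^d be compact and measurable, fix w ∈ ℝ^N and pairwise distinct points z_1,…,z_N ∈ ℝ^d, and assume the tie-null condition holds at w for the costs c_j(x) = ‖x − z_j‖². Fix an index i, and consider the function G : ℝ^d → ℝ defined by G(z) = ∫_Ω min_{j=1,…,N} (‖x − ζ_j‖² − w_j) dx, where ζ_j = z_j for j ≠ i and ζ_i = z. Then G is differentiable at z = z_i with gradient ∇G(z_i) = ∫_{L_i(w)} 2(z_i − x) dx = 2·vol(L_i(w))·z_i − 2·∫_{L_i(w)} x dx; in particular, the negative gradient −∇G(z_i) points from z_i toward the barycenter of the Laguerre cell L_i(w). -/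
open MeasureTheory

lemma env_iInf_abs_sub_le {N : ℕ} [Nonempty (Fin N)] (f g : Fin N → ℝ) (C : ℝ)
    (h : ∀ j, |f j - g j| ≤ C) : |(⨅ j, f j) - ⨅ j, g j| ≤ C := by
  have key : ∀ f g : Fin N → ℝ, (∀ j, |f j - g j| ≤ C) → (⨅ j, f j) - C ≤ ⨅ j, g j := by
    intro f g h
    refine le_ciInf fun j => ?_
    have h1 : (⨅ j, f j) ≤ f j := ciInf_le (Set.finite_range f).bddBelow j
    have h2 := (abs_le.1 (h j)).2
    linarith
  have h1 := key f g h
  have h2 := key g f (fun j => by rw [abs_sub_comm]; exact h j)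
  rw [abs_le]
  constructor <;> linarith

lemma env_continuous {d N : ℕ} [Nonempty (Fin N)] (p : Fin N → EuclideanSpace ℝ (Fin d))
    (w : Fin N → ℝ) : Continuous fun x => ⨅ j, (‖x - p j‖ ^ 2 - w j) := by
  have : (fun x => ⨅ j, (‖x - p j‖ ^ 2 - w j)) =
      fun x => Finset.univ.inf' Finset.univ_nonempty (fun j => ‖x - p j‖ ^ 2 - w j) := by
    funext x
    rw [Finset.inf'_univ_eq_ciInf]
  rw [this]
  exact Continuous.finset_inf'_apply _ (fun j _ => by fun_prop)

lemma env_iInf_le {d N : ℕ} (pts : Fin N → EuclideanSpace ℝ (Fin d))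
    (w : Fin N → ℝ) (i j : Fin N) (hji : j ≠ i) (x z z' : EuclideanSpace ℝ (Fin d))
    (h' : ‖x - pts j‖ ^ 2 - w j < ‖x - z'‖ ^ 2 - w i) :
    (⨅ k, (‖x - Function.update pts i z k‖ ^ 2 - w k)) ≤
      ⨅ k, (‖x - Function.update pts i z' k‖ ^ 2 - w k) := by
  have : Nonempty (Fin N) := ⟨i⟩
  have hle : ∀ k, (⨅ k, (‖x - Function.update pts i z k‖ ^ 2 - w k)) ≤
      ‖x - Function.update pts i z k‖ ^ 2 - w k :=
    fun k => ciInf_le (Set.finite_range _).bddBelow k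
  refine le_ciInf fun k => ?_
  by_cases hk : k = i
  · subst hk
    have := hle j
    rw [Function.update_of_ne hji] at this
    rw [Function.update_self]
    linarith
  · have := hle k
    rw [Function.update_of_ne hk] at this ⊢
    exact this

lemma env_hasFDerivAt_sq {d : ℕ} (x z : EuclideanSpace ℝ (Fin d)) (c : ℝ) :
    HasFDerivAt (fun y => ‖x - y‖ ^ 2 - c) (innerSL ℝ ((2 : ℝ) • (z - x))) z := by
  have h := (((hasFDerivAt_id (𝕜 := ℝ) z).const_sub x).norm_sq).sub_const c
  refine h.congr_fderiv ?_
  ext v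
  simp

/-- Envelope formula for the incompressibility force with the squared
Euclidean cost: the function
`G(z) = ∫_Ω min_j (‖x − ζ_j‖² − w_j) dx` (where `ζ_j = pts j` for `j ≠ i` and
`ζ_i = z`) is differentiable at `z = pts i` with gradient
`∫_{L_i(w)} 2(pts i − x) dx = 2 vol(L_i(w)) • pts i − 2 ∫_{L_i(w)} x dx`. -/
theorem envelope_formula {d N : ℕ} (hd : 1 ≤ d) (hN : 1 ≤ N)
    (Ω : Set (EuclideanSpace ℝ (Fin d))) (hΩcomp : IsCompact Ω)
    (hΩmeas : MeasurableSet Ω)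
    (pts : Fin N → EuclideanSpace ℝ (Fin d))
    (hpts : Function.Injective pts)
    (w : Fin N → ℝ)
    (htie : TieNull Ω (fun j x => ‖x - pts j‖ ^ 2) w)
    (i : Fin N) :
    HasGradientAt
      (fun z : EuclideanSpace ℝ (Fin d) =>
        ∫ x in Ω, ⨅ j, (‖x - Function.update pts i z j‖ ^ 2 - w j))
      (∫ x in LaguerreCell Ω (fun j x => ‖x - pts j‖ ^ 2) w i,
        (2 : ℝ) • (pts i - x))
      (pts i) ∧
    (∫ x in LaguerreCell Ω (fun j x => ‖x - pts j‖ ^ 2) w i,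
        (2 : ℝ) • (pts i - x))
      = (2 * (volume (LaguerreCell Ω (fun j x => ‖x - pts j‖ ^ 2) w i)).toReal)
          • pts i
        - (2 : ℝ) • ∫ x in LaguerreCell Ω (fun j x => ‖x - pts j‖ ^ 2) w i, x := by
  classical
  have hne : Nonempty (Fin N) := ⟨i⟩
  set L := LaguerreCell Ω (fun j x => ‖x - pts j‖ ^ 2) w i with hL
  have hLeq : L = Ω ∩ ⋂ j, {x | ‖x - pts i‖ ^ 2 - w i ≤ ‖x - pts j‖ ^ 2 - w j} := by
    ext x
    simp [hL, LaguerreCell]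
  have hLmeas : MeasurableSet L := by
    rw [hLeq]
    refine hΩmeas.inter (MeasurableSet.iInter fun j => ?_)
    exact (isClosed_le (by fun_prop) (by fun_prop)).measurableSet
  have hLsub : L ⊆ Ω := by
    rw [hLeq]
    exact Set.inter_subset_left
  have hgint : IntegrableOn (fun x => (2 : ℝ) • (pts i - x)) L :=
    (ContinuousOn.integrableOn_compact hΩcomp (by fun_prop)).mono_set hLsub
  have hidint : IntegrableOn (fun x : EuclideanSpace ℝ (Fin d) => x) L :=
    (ContinuousOn.integrableOn_compact hΩcomp (by fun_prop)).mono_set hLsub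
  have hcint : IntegrableOn (fun _ : EuclideanSpace ℝ (Fin d) => pts i) L :=
    (ContinuousOn.integrableOn_compact hΩcomp (by fun_prop)).mono_set hLsub
  refine ⟨?_, ?_⟩
  swap
  · rw [integral_smul, integral_sub hcint hidint, setIntegral_const, smul_sub, smul_smul]
    rfl
  rw [hasGradientAt_iff_hasFDerivAt]
  let F' : EuclideanSpace ℝ (Fin d) → (EuclideanSpace ℝ (Fin d) →L[ℝ] ℝ) :=
    L.indicator fun x => innerSL ℝ ((2 : ℝ) • (pts i - x))
  have hF'c : Continuous fun x => innerSL ℝ ((2 : ℝ) • (pts i - x)) :=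
    (innerSL ℝ).continuous.comp (by fun_prop)
  have htie' : ∀ᵐ x ∂(volume.restrict Ω), ∀ j, j ≠ i →
      ‖x - pts i‖ ^ 2 - w i ≠ ‖x - pts j‖ ^ 2 - w j := by
    rw [ae_all_iff]
    intro j
    by_cases hj : j = i
    · simp [hj]
    rw [ae_restrict_iff' hΩmeas, ae_iff]
    refine measure_mono_null ?_ (htie i j (Ne.symm hj))
    intro x hx
    simp only [Set.mem_ofPred_eq, Classical.not_imp, not_not] at hx ⊢
    exact ⟨hx.1, hx.2.2⟩
  have main := hasFDerivAt_integral_of_dominated_loc_of_lip' (𝕜 := ℝ)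
    (μ := volume.restrict Ω)
    (F := fun z x => ⨅ j, (‖x - Function.update pts i z j‖ ^ 2 - w j)) (F' := F')
    (x₀ := pts i) (bound := fun x => 2 * ‖x - pts i‖ + 1)
    (Metric.ball_mem_nhds (pts i) one_pos)
    (fun z _ => (env_continuous _ w).aestronglyMeasurable)
    ((env_continuous _ w).continuousOn.integrableOn_compact hΩcomp)
    (hF'c.aestronglyMeasurable.indicator hLmeas)
    ?_ (ContinuousOn.integrableOn_compact hΩcomp (by fun_prop)) ?_
  · obtain ⟨hint, hder⟩ := main
    refine hder.congr_fderiv ?_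
    symm
    ext v
    rw [ContinuousLinearMap.integral_apply hint, InnerProductSpace.toDual_apply_apply,
      real_inner_comm, ← integral_inner hgint]
    have : ∀ x, F' x v = L.indicator (fun x => inner ℝ v ((2 : ℝ) • (pts i - x))) x := by
      intro x
      by_cases hx : x ∈ L
      · simp only [F', Set.indicator_of_mem hx, innerSL_apply_apply]
        rw [real_inner_comm]
      · simp [F', Set.indicator_of_notMem hx]
    simp_rw [this]
    rw [setIntegral_indicator hLmeas, Set.inter_eq_self_of_subset_right hLsub]
  · refine Filter.Eventually.of_forall fun x z hz => ?_
    rw [Real.norm_eq_abs]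
    have hz1 : ‖z - pts i‖ < 1 := by simpa [dist_eq_norm] using hz
    have hpos : 0 ≤ (2 * ‖x - pts i‖ + 1) * ‖z - pts i‖ := by positivity
    refine env_iInf_abs_sub_le _ _ _ fun j => ?_
    by_cases hj : j = i
    · subst hj
      simp only [Function.update_self]
      have h1 : |‖x - z‖ - ‖x - pts j‖| ≤ ‖z - pts j‖ := by
        have := abs_norm_sub_norm_le (x - z) (x - pts j)
        rwa [sub_sub_sub_cancel_left, norm_sub_rev (pts j) z] at this
      have h2 : ‖x - z‖ + ‖x - pts j‖ ≤ 2 * ‖x - pts j‖ + 1 := by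
        have := (abs_le.1 h1).2
        linarith
      have h3 : ‖x - z‖ ^ 2 - w j - (‖x - pts j‖ ^ 2 - w j) =
        (‖x - z‖ + ‖x - pts j‖) * (‖x - z‖ - ‖x - pts j‖) := by ring
      rw [h3, abs_mul, abs_of_nonneg (by positivity : 0 ≤ ‖x - z‖ + ‖x - pts j‖)]
      gcongr
    · rw [Function.update_of_ne hj, Function.update_of_ne hj, sub_self, abs_zero]
      exact hpos
  · filter_upwards [htie', ae_restrict_mem hΩmeas] with x hx hxΩ
    have hcont : Continuous fun z => ‖x - z‖ ^ 2 - w i := by fun_prop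
    by_cases hxL : x ∈ L
    · have hxL' : ∀ j, ‖x - pts i‖ ^ 2 - w i ≤ ‖x - pts j‖ ^ 2 - w j := hxL.2
      simp only [F', Set.indicator_of_mem hxL]
      refine (env_hasFDerivAt_sq x (pts i) (w i)).congr_of_eventuallyEq ?_
      have hev : ∀ᶠ z in nhds (pts i), ∀ j, j ≠ i →
          ‖x - z‖ ^ 2 - w i < ‖x - pts j‖ ^ 2 - w j := by
        rw [Filter.eventually_all]
        intro j
        by_cases hj : j = i
        · simp [hj]
        filter_upwards [hcont.continuousAt.eventually_lt_const
          (lt_of_le_of_ne (hxL' j) (hx j hj))] with z hz _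
        exact hz
      filter_upwards [hev] with z hz
      apply le_antisymm
      · have := ciInf_le (Set.finite_range
          (fun j => ‖x - Function.update pts i z j‖ ^ 2 - w j)).bddBelow i
        simpa using this
      · refine le_ciInf fun j => ?_
        by_cases hj : j = i
        · subst hj; simp
        · rw [Function.update_of_ne hj]
          exact (hz j hj).le
    · have : ∃ j, ‖x - pts j‖ ^ 2 - w j < ‖x - pts i‖ ^ 2 - w i := by
        by_contra hcon
        push Not at hcon
        exact hxL ⟨hxΩ, hcon⟩
      obtain ⟨j, hj⟩ := this
      have hji : j ≠ i := by
        rintro rfl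
        exact lt_irrefl _ hj
      simp only [F', Set.indicator_of_notMem hxL]
      refine (hasFDerivAt_const
        (⨅ k, (‖x - Function.update pts i (pts i) k‖ ^ 2 - w k)) (pts i)).congr_of_eventuallyEq ?_
      filter_upwards [hcont.continuousAt.eventually_const_lt hj] with z hz
      exact le_antisymm (env_iInf_le pts w i j hji x _ _ hj) (env_iInf_le pts w i j hji x _ _ hz)
end
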